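/- arXiv:1804.10014 — 4 statements merged into one kernel-verified Lean document; each statement's English description precedes it below -/
import Mathlib

section
/- For every integer ℓ ≥ 2 there exists a constant C = C(ℓ) > 0 such that for all integers t ≥ 2 and n ≥ 1, every Θ_{ℓ,t}-free graph on n vertices has at most C · t^{1−1/ℓ} · n^{1+1/ℓ} edges; that is, ex(n, Θ_{ℓ,t}) ≤ C t^{1−1/ℓ} n^{1+1/ℓ}. -/
/-- `G` contains the theta graph `Θ_{ℓ,t}`: there are two distinct vertices `x, y`
joined by `t` paths of length exactly `ℓ`, any two of which share no vertices
other than `x` and `y`. -/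
def SimpleGraph.HasTheta {V : Type*} (G : SimpleGraph V) (ℓ t : ℕ) : Prop :=
  ∃ (x y : V) (p : Fin t → Fin (ℓ + 1) → V),
    x ≠ y ∧
    (∀ i, p i 0 = x) ∧
    (∀ i, p i (Fin.last ℓ) = y) ∧
    (∀ i, Function.Injective (p i)) ∧
    (∀ i (j : Fin ℓ), G.Adj (p i j.castSucc) (p i j.succ)) ∧
    (∀ i i', i ≠ i' → ∀ j j', p i j = p i' j' → p i j = x ∨ p i j = y)

namespace ThetaTuran

open Classical in
/-- All lists of length `n` over a finite type. -/
noncomputable def lists (V : Type*) [Fintype V] (n : ℕ) : Finset (List V) :=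
  (List.finite_length_eq V n).toFinset

section Lists

variable {V : Type*} [Fintype V]

@[simp] lemma mem_lists {n : ℕ} {p : List V} : p ∈ lists V n ↔ p.length = n := by
  simp [lists]

lemma sum_lists_zero (g : List V → ℝ) : ∑ p ∈ lists V 0, g p = g [] := by
  rw [Finset.sum_eq_single []] <;> simp

lemma sum_lists_add (m n : ℕ) (g : List V → ℝ) :
    ∑ p ∈ lists V (m + n), g p = ∑ q ∈ lists V m, ∑ r ∈ lists V n, g (q ++ r) := by
  rw [← Finset.sum_product']
  refine Finset.sum_nbij' (fun p => (p.take m, p.drop m)) (fun qr => qr.1 ++ qr.2) ?_ ?_ ?_ ?_ ?_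
  · intro p hp
    simp only [mem_lists, Finset.mem_product, List.length_take, List.length_drop] at hp ⊢
    omega
  · intro qr h
    simp only [mem_lists, Finset.mem_product, List.length_append] at h ⊢
    omega
  · intro p _
    simp
  · rintro ⟨q, r⟩ h
    simp only [mem_lists, Finset.mem_product] at h
    simp [← h.1]
  · intro p _
    simp

lemma sum_lists_one (g : List V → ℝ) : ∑ p ∈ lists V 1, g p = ∑ v : V, g [v] := by
  refine (Finset.sum_nbij (fun v => [v]) ?_ ?_ ?_ ?_).symm
  · simp
  · intro a _ b _ h
    simpa using h
  · intro p hp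
    simp only [Finset.mem_coe, mem_lists, List.length_eq_one_iff] at hp
    obtain ⟨v, rfl⟩ := hp
    simp
  · simp

lemma sum_lists_cons (n : ℕ) (g : List V → ℝ) :
    ∑ p ∈ lists V (n + 1), g p = ∑ v : V, ∑ q ∈ lists V n, g (v :: q) := by
  rw [add_comm, sum_lists_add, sum_lists_one]
  rfl

lemma sum_lists_concat (n : ℕ) (g : List V → ℝ) :
    ∑ p ∈ lists V (n + 1), g p = ∑ q ∈ lists V n, ∑ v : V, g (q ++ [v]) := by
  rw [sum_lists_add]
  exact Finset.sum_congr rfl fun q _ => sum_lists_one _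

end Lists

open Classical

variable {V : Type*} (G : SimpleGraph V)

/-- Walks from `x` to `y` are given by their list `p` of internal vertices. -/
abbrev IsWalk (x : V) (p : List V) (y : V) : Prop := (x :: (p ++ [y])).IsChain G.Adj

lemma isWalk_append {x y z : V} {q r : List V} :
    IsWalk G x (q ++ z :: r) y ↔ IsWalk G x q z ∧ IsWalk G z r y := by
  have := List.isChain_split (R := G.Adj) (c := z) (l₁ := x :: q) (l₂ := r ++ [y])
  simpa [IsWalk] using this

lemma isWalk_concat {x y z : V} {q : List V} :
    IsWalk G x (q ++ [z]) y ↔ IsWalk G x q z ∧ G.Adj z y := by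
  rw [isWalk_append]
  simp [IsWalk]

lemma isWalk_cons {x y z : V} {r : List V} :
    IsWalk G x (z :: r) y ↔ G.Adj x z ∧ IsWalk G z r y := by
  simp [IsWalk]

/-- Even after deleting any `N` vertices there is a path with `n` internal vertices. -/
def Linked (G : SimpleGraph V) (N n : ℕ) (x y : V) : Prop :=
  ∀ S : Finset V, S.card ≤ N →
    ∃ p : List V, p.length = n ∧ IsWalk G x p y ∧ (x :: (p ++ [y])).Nodup ∧ ∀ v ∈ p, v ∉ S

/-- Vertices reached from `A 0` by walks through the successive sets `A m`, each step having many
choices, are still linked to `x`. -/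
lemma Linked.extend {G : SimpleGraph V} {N M n : ℕ} {x : V} {A : ℕ → Finset V}
    (h0 : ∀ y ∈ A 0, Linked G N n x y)
    (hA : ∀ m, ∀ u ∈ A (m + 1), ∀ S : Finset V, S.card ≤ N → ∃ v ∈ A m, G.Adj v u ∧ v ∉ S)
    (m : ℕ) (hM : M + m + 2 ≤ N) (u : V) (hu : u ∈ A m) (hux : u ≠ x) :
    Linked G M (n + m) x u := by
  induction m generalizing M u with
  | zero => exact fun S hS => h0 u hu S (by omega)
  | succ m ih =>
    intro S hS
    obtain ⟨v, hv, hadj, hvS⟩ := hA m u hu (insert u (insert x S)) (by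
      have := Finset.card_insert_le u (insert x S)
      have := Finset.card_insert_le x S
      omega)
    simp only [Finset.mem_insert, not_or] at hvS
    obtain ⟨p, hlen, hw, hnd, hp⟩ := ih (M := M + 1) (by omega) v hv hvS.2.1 (insert u S) (by
      have := Finset.card_insert_le u S
      omega)
    refine ⟨p ++ [v], by simp [hlen, add_assoc], (isWalk_concat G).2 ⟨hw, hadj⟩, ?_, ?_⟩
    · have hup : u ∉ p := fun h => hp u h (Finset.mem_insert_self u S)
      have : u ∉ x :: (p ++ [v]) := by
        simp [hux, hup, Ne.symm hvS.1]
      have h2 := List.nodup_append.2 ⟨hnd, List.nodup_singleton u, by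
        intro b hb c hc hbc
        simp only [List.mem_singleton] at hc
        exact this (hc ▸ hbc ▸ hb)⟩
      simpa using h2
    · intro b hb
      rcases List.mem_append.1 hb with hb | hb
      · exact fun h => hp b hb (Finset.mem_insert_of_mem h)
      · rw [List.mem_singleton.1 hb]
        exact hvS.2.2

/-- A subwalk is the whole walk, or lies in the initial or the final part of it. -/
lemma infix_walk {x y b c : V} {p q : List V} (h : (b :: (q ++ [c])) <:+: (x :: (p ++ [y]))) :
    (b = x ∧ q = p ∧ c = y) ∨
    (∃ p' z, p = p' ++ [z] ∧ (b :: (q ++ [c])) <:+: (x :: (p' ++ [z]))) ∨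
    (∃ z p', p = z :: p' ∧ (b :: (q ++ [c])) <:+: (z :: (p' ++ [y]))) := by
  rcases List.infix_cons_iff.1 h with h | h
  · rw [← List.cons_append, ← List.cons_append, List.prefix_concat_iff] at h
    rcases h with h | h
    · obtain ⟨h1, h2⟩ := List.append_inj' h rfl
      simp only [List.cons.injEq, and_true] at h1 h2
      exact Or.inl ⟨h1.1, h1.2, h2⟩
    · rcases List.eq_nil_or_concat p with rfl | ⟨p', z, rfl⟩
      · have := h.length_le
        simp at this
      · exact Or.inr (Or.inl ⟨p', z, by simp, by simpa using h.isInfix⟩)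
  · rcases p with _ | ⟨z, p'⟩
    · have := h.length_le
      simp at this
    · exact Or.inr (Or.inr ⟨z, p', rfl, h⟩)

/-- Greedily chosen internally disjoint paths. -/
lemma Linked.exists_disjoint {G : SimpleGraph V} {t K : ℕ} {x y : V}
    (h : Linked G (t * K) K x y) (s : ℕ) (hs : s ≤ t) :
    ∃ ps : ℕ → List V, ∀ i < s, (ps i).length = K ∧ IsWalk G x (ps i) y ∧
      (x :: (ps i ++ [y])).Nodup ∧ ∀ j < i, ∀ v ∈ ps i, v ∉ ps j := by
  induction s with
  | zero => exact ⟨fun _ => [], by simp⟩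
  | succ s ih =>
    obtain ⟨ps, hps⟩ := ih (by omega)
    obtain ⟨p, hlen, hw, hnd, hp⟩ := h ((Finset.range s).biUnion fun i => (ps i).toFinset) (by
      have := Finset.card_biUnion_le_card_mul (Finset.range s) (fun i => (ps i).toFinset) K
        fun i hi => (List.toFinset_card_le _).trans (hps i (Finset.mem_range.1 hi)).1.le
      rw [Finset.card_range] at this
      exact this.trans (Nat.mul_le_mul_right K (by omega)))
    refine ⟨Function.update ps s p, fun i hi => ?_⟩
    rcases (Nat.lt_succ_iff.1 hi).lt_or_eq with hlt | rfl
    · rw [Function.update_of_ne hlt.ne]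
      obtain ⟨h1, h2, h3, h4⟩ := hps i hlt
      refine ⟨h1, h2, h3, fun j hj => ?_⟩
      rw [Function.update_of_ne (hj.trans hlt).ne]
      exact h4 j hj
    · rw [Function.update_self]
      refine ⟨hlen, hw, hnd, fun j hj v hv hv' => ?_⟩
      rw [Function.update_of_ne hj.ne] at hv'
      exact hp v hv (Finset.mem_biUnion.2 ⟨j, Finset.mem_range.2 hj, List.mem_toFinset.2 hv'⟩)

lemma Linked.hasTheta {G : SimpleGraph V} {t K : ℕ} {x y : V} (hxy : x ≠ y)
    (h : Linked G (t * K) K x y) : G.HasTheta (K + 1) t := by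
  obtain ⟨ps, hps⟩ := h.exists_disjoint t le_rfl
  have hlen : ∀ i : Fin t, (x :: (ps i ++ [y])).length = K + 1 + 1 := fun i => by
    simp [(hps i i.2).1]
  have hmem : ∀ (i : Fin t) (j : ℕ) (hj : j < (x :: (ps i ++ [y])).length),
      (x :: (ps i ++ [y]))[j] = x ∨ (x :: (ps i ++ [y]))[j] = y ∨
        (x :: (ps i ++ [y]))[j] ∈ ps i := by
    intro i j hj
    have := List.getElem_mem hj
    simp only [List.mem_cons, List.mem_append, List.not_mem_nil, or_false] at this
    tauto
  have hdisj : ∀ i i' : Fin t, i ≠ i' → ∀ v ∈ ps i, v ∉ ps i' := by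
    intro i i' hne v hv hv'
    rcases lt_or_gt_of_ne hne with hlt | hlt
    · exact (hps i' i'.2).2.2.2 i hlt v hv' hv
    · exact (hps i i.2).2.2.2 i' hlt v hv hv'
  refine ⟨x, y, fun i j => (x :: (ps i ++ [y]))[(j : ℕ)]'((hlen i).symm ▸ j.2), hxy, ?_, ?_, ?_,
    ?_, ?_⟩
  · intro i
    simp
  · intro i
    have := (hps i i.2).1
    simp [← this]
  · intro i j j' hjj
    exact Fin.ext (((hps i i.2).2.2.1.getElem_inj_iff).1 hjj)
  · intro i j
    have := List.isChain_iff_getElem.1 (hps i i.2).2.1 j (by rw [hlen]; omega)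
    simpa using this
  · intro i i' hne j j' hjj
    have hj := hmem i j ((hlen i).symm ▸ j.2)
    have hj' := hmem i' j' ((hlen i').symm ▸ j'.2)
    dsimp only at hjj ⊢
    rcases hj with hj | hj | hj
    · exact Or.inl hj
    · exact Or.inr hj
    · rw [hjj] at hj ⊢
      rcases hj' with hj' | hj' | hj'
      · exact Or.inl hj'
      · exact Or.inr hj'
      · exact absurd hj' (hdisj i i' hne _ hj)

lemma hasTheta_of_induce {G : SimpleGraph V} {s : Set V} {ℓ t : ℕ}
    (h : (G.induce s).HasTheta ℓ t) : G.HasTheta ℓ t := by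
  obtain ⟨x, y, p, hxy, h0, h1, hinj, hadj, hdisj⟩ := h
  refine ⟨x, y, fun i j => p i j, fun h => hxy (Subtype.ext h), fun i => congrArg _ (h0 i),
    fun i => congrArg _ (h1 i), fun i => Subtype.val_injective.comp (hinj i),
    fun i j => hadj i j, ?_⟩
  intro i i' hne j j' h
  exact (hdisj i i' hne j j' (Subtype.ext h)).imp (congrArg _) (congrArg _)

variable [Fintype V]

/-- The weight of a walk with list of internal vertices `p`: the product of their inverse
degrees. -/
noncomputable def wt (p : List V) : ℝ := (p.map fun v => (G.degree v : ℝ)⁻¹).prod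

@[simp] lemma wt_nil : wt G [] = 1 := by simp [wt]

@[simp] lemma wt_cons (v : V) (p : List V) : wt G (v :: p) = (G.degree v : ℝ)⁻¹ * wt G p := by
  simp [wt]

@[simp] lemma wt_append (p q : List V) : wt G (p ++ q) = wt G p * wt G q := by
  simp [wt]

lemma wt_nonneg (p : List V) : 0 ≤ wt G p := by
  induction p with
  | nil => simp
  | cons v p ih => rw [wt_cons]; positivity

lemma sum_adj_const (z : V) (c : ℝ) :
    ∑ y : V, (if G.Adj z y then c else 0) = G.degree z * c := by
  rw [← Finset.sum_filter, Finset.sum_const, nsmul_eq_mul, ← G.neighborFinset_eq_filter,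
    G.card_neighborFinset_eq_degree]

lemma sum_walks_from (hG : ∀ v, 0 < G.degree v) (x : V) (n : ℕ) :
    ∑ p ∈ lists V n, ∑ y : V, (if IsWalk G x p y then wt G p else 0) = G.degree x := by
  induction n with
  | zero =>
    rw [sum_lists_zero]
    simpa [IsWalk] using sum_adj_const G x 1
  | succ n ih =>
    rw [sum_lists_concat, ← ih]
    refine Finset.sum_congr rfl fun q _ => Finset.sum_congr rfl fun z _ => ?_
    by_cases h : IsWalk G x q z
    · simp only [isWalk_concat, h, true_and, if_true, sum_adj_const]
      have : (G.degree z : ℝ) ≠ 0 := by exact_mod_cast (hG z).ne'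
      simp
      field_simp
    · simp [isWalk_concat, h]

/-- A pair of vertices is light if the walks between them whose proper subwalks are all light
have small total weight. -/
noncomputable def Light (a : ℝ) (n : ℕ) (x y : V) : Prop :=
  ∑ p ∈ lists V n, (if IsWalk G x p y ∧ (x :: (p ++ [y])).Nodup ∧
    ∀ b q c, (b :: (q ++ [c])) <:+: (x :: (p ++ [y])) → ∀ _ : q.length < n,
      Light a q.length b c then wt G p else 0) ≤ 2 * a ^ n
termination_by n

/-- Paths all of whose proper subpaths have light pairs of ends. -/
structure Admissible (a : ℝ) (x : V) (p : List V) (y : V) : Prop where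
  isWalk : IsWalk G x p y
  nodup : (x :: (p ++ [y])).Nodup
  light : ∀ b q c, (b :: (q ++ [c])) <:+: (x :: (p ++ [y])) → q.length < p.length →
    Light G a q.length b c

lemma light_iff {a : ℝ} {n : ℕ} {x y : V} : Light G a n x y ↔
    ∑ p ∈ lists V n, (if Admissible G a x p y then wt G p else 0) ≤ 2 * a ^ n := by
  rw [Light]
  have : ∀ p ∈ lists V n, (IsWalk G x p y ∧ (x :: (p ++ [y])).Nodup ∧
    ∀ b q c, (b :: (q ++ [c])) <:+: (x :: (p ++ [y])) → ∀ _ : q.length < n,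
      Light G a q.length b c) ↔ Admissible G a x p y := by
    intro p hp
    rw [mem_lists] at hp
    subst hp
    exact ⟨fun h => ⟨h.1, h.2.1, h.2.2⟩, fun h => ⟨h.1, h.2, h.3⟩⟩
  rw [Finset.sum_congr rfl fun p hp => if_congr (this p hp) rfl rfl]

variable {G}

lemma Admissible.of_infix {a : ℝ} {x y x' y' : V} {p p' : List V} (h : Admissible G a x p y)
    (hi : (x' :: (p' ++ [y'])) <:+: (x :: (p ++ [y]))) : Admissible G a x' p' y' where
  isWalk := h.isWalk.infix hi
  nodup := h.nodup.sublist hi.sublist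
  light b q c hq hl := h.light b q c (hq.trans hi) (hl.trans_le (by simpa using hi.length_le))

lemma Admissible.split {a : ℝ} {x y z : V} {q r : List V}
    (h : Admissible G a x (q ++ z :: r) y) :
    (Admissible G a x q z ∧ Light G a q.length x z) ∧
      (Admissible G a z r y ∧ Light G a r.length z y) := by
  have h1 : (x :: (q ++ [z])) <:+: (x :: ((q ++ z :: r) ++ [y])) := ⟨[], r ++ [y], by simp⟩
  have h2 : (z :: (r ++ [y])) <:+: (x :: ((q ++ z :: r) ++ [y])) := ⟨x :: q, [], by simp⟩
  exact ⟨⟨h.of_infix h1, h.light _ _ _ h1 (by simp)⟩,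
    ⟨h.of_infix h2, h.light _ _ _ h2 (by simp; omega)⟩⟩

lemma sum_admissible_through_le {a d : ℝ} (ha : 0 ≤ a) (hd : 0 < d) (x y z : V)
    (hz : d ≤ G.degree z) (m n : ℕ) :
    ∑ q ∈ lists V m, ∑ r ∈ lists V n,
      (if Admissible G a x (q ++ z :: r) y then wt G (q ++ z :: r) else 0) ≤
      4 * a ^ (m + n) / d := by
  by_cases hL : Light G a m x z ∧ Light G a n z y
  · have h1 := (light_iff G).1 hL.1
    have h2 := (light_iff G).1 hL.2
    set s := ∑ p ∈ lists V m, (if Admissible G a x p z then wt G p else 0) with hs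
    set u := ∑ p ∈ lists V n, (if Admissible G a z p y then wt G p else 0) with hu
    have hu0 : 0 ≤ u := Finset.sum_nonneg fun p _ => by split_ifs <;> simp [wt_nonneg]
    have hle : ∑ q ∈ lists V m, ∑ r ∈ lists V n,
        (if Admissible G a x (q ++ z :: r) y then wt G (q ++ z :: r) else 0) ≤
        (s * u) * (G.degree z : ℝ)⁻¹ := by
      rw [hs, hu, Finset.sum_mul_sum, Finset.sum_mul]
      refine Finset.sum_le_sum fun q _ => ?_
      rw [Finset.sum_mul]
      refine Finset.sum_le_sum fun r _ => ?_
      by_cases h : Admissible G a x (q ++ z :: r) y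
      · rw [if_pos h, if_pos h.split.1.1, if_pos h.split.2.1]
        simp only [wt_append, wt_cons]
        exact le_of_eq (by ring)
      · rw [if_neg h]
        have := wt_nonneg G q
        have := wt_nonneg G r
        positivity
    calc _ ≤ _ := hle
      _ ≤ ((2 * a ^ m) * (2 * a ^ n)) * d⁻¹ := by gcongr
      _ = _ := by rw [pow_add]; ring
  · rw [Finset.sum_eq_zero]
    · positivity
    · intro q hq
      refine Finset.sum_eq_zero fun r hr => if_neg fun h => hL ?_
      rw [mem_lists] at hq hr
      subst hq hr
      exact ⟨h.split.1.2, h.split.2.2⟩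

/-- A family of admissible paths of large weight contains a path avoiding any given small set. -/
lemma exists_admissible_avoiding {a d : ℝ} {N k n : ℕ} (ha : 0 < a) (hd : 0 < d)
    (hG : ∀ v, d ≤ G.degree v) (had : 4 * (N * k : ℝ) < a * d) (hn : n + 1 ≤ k) (x y : V)
    (R : List V → Prop)
    (hR : a ^ (n + 1) ≤
      ∑ p ∈ lists V (n + 1), (if Admissible G a x p y ∧ R p then wt G p else 0))
    (S : Finset V) (hS : S.card ≤ N) :
    ∃ p ∈ lists V (n + 1), Admissible G a x p y ∧ R p ∧ ∀ v ∈ p, v ∉ S := by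
  by_contra! hcon
  refine hR.not_gt ?_
  have hb : ∀ p ∈ lists V (n + 1), (if Admissible G a x p y ∧ R p then wt G p else 0) ≤
      ∑ j ∈ Finset.range (n + 1), ∑ s ∈ S,
        (if Admissible G a x p y ∧ p[j]? = some s then wt G p else 0) := by
    intro p hp
    have hnn : ∀ (j : ℕ) (s : V),
        0 ≤ (if Admissible G a x p y ∧ p[j]? = some s then wt G p else 0) := by
      intro j s
      split_ifs <;> simp [wt_nonneg]
    split_ifs with h
    · obtain ⟨v, hv, hvS⟩ := hcon p hp h.1 h.2
      obtain ⟨j, hj, rfl⟩ := List.getElem_of_mem hv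
      rw [mem_lists] at hp
      calc wt G p = (if Admissible G a x p y ∧ p[j]? = some p[j] then wt G p else 0) := by
            rw [if_pos ⟨h.1, List.getElem?_eq_getElem hj⟩]
        _ ≤ ∑ s ∈ S, (if Admissible G a x p y ∧ p[j]? = some s then wt G p else 0) :=
            Finset.single_le_sum
              (f := fun s => (if Admissible G a x p y ∧ p[j]? = some s then wt G p else 0))
              (fun s _ => hnn j s) hvS
        _ ≤ _ := Finset.single_le_sum
              (f := fun j => ∑ s ∈ S,
                (if Admissible G a x p y ∧ p[j]? = some s then wt G p else 0))
              (fun j _ => Finset.sum_nonneg fun s _ => hnn j s)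
              (Finset.mem_range.2 (by omega))
    · exact Finset.sum_nonneg fun j _ => Finset.sum_nonneg fun s _ => hnn j s
  have hj : ∀ j ∈ Finset.range (n + 1), ∀ s ∈ S, ∑ p ∈ lists V (n + 1),
      (if Admissible G a x p y ∧ p[j]? = some s then wt G p else 0) ≤ 4 * a ^ n / d := by
    intro j hj s _
    rw [Finset.mem_range] at hj
    obtain ⟨m, rfl⟩ : ∃ m, n = j + m := ⟨n - j, by omega⟩
    rw [add_assoc, sum_lists_add]
    refine le_trans (le_of_eq ?_) (sum_admissible_through_le ha.le hd x y s (hG s) j m)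
    refine Finset.sum_congr rfl fun q hq => ?_
    rw [mem_lists] at hq
    subst hq
    rw [sum_lists_cons, Finset.sum_eq_single s]
    · simp
    · intro v _ hv
      exact Finset.sum_eq_zero fun r _ => if_neg (by simp [hv])
    · simp
  calc _ ≤ _ := Finset.sum_le_sum hb
    _ = ∑ j ∈ Finset.range (n + 1), ∑ s ∈ S, ∑ p ∈ lists V (n + 1),
        (if Admissible G a x p y ∧ p[j]? = some s then wt G p else 0) := by
        rw [Finset.sum_comm]
        exact Finset.sum_congr rfl fun j _ => Finset.sum_comm
    _ ≤ ∑ j ∈ Finset.range (n + 1), ∑ s ∈ S, 4 * a ^ n / d :=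
        Finset.sum_le_sum fun j h => Finset.sum_le_sum fun s h' => hj j h s h'
    _ = (4 * (S.card * (n + 1 : ℕ) : ℝ)) * a ^ n / d := by
        simp only [Finset.sum_const, Finset.card_range, nsmul_eq_mul]
        ring
    _ ≤ (4 * (N * k : ℝ)) * a ^ n / d := by gcongr
    _ < (a * d) * a ^ n / d := by gcongr
    _ = a ^ (n + 1) := by rw [pow_succ]; field_simp

/-- If no vertex is robustly linked to `x`, the admissible paths from `x` with a heavy pair of ends
have small total weight. -/
lemma sum_heavy_le {a d : ℝ} {N M K n : ℕ} (ha : 0 < a) (hd : 0 < d)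
    (hG : ∀ v, d ≤ G.degree v) (had : 4 * (N * K : ℝ) < a * d) (hn : n + 1 ≤ K)
    (hMN : M + K + 2 ≤ N) (x : V) (hfree : ∀ y, y ≠ x → ¬ Linked G M K x y) :
    ∑ p ∈ lists V (n + 1), ∑ y : V,
      (if Admissible G a x p y ∧ ¬ Light G a (n + 1) x y then wt G p else 0) ≤
      2 * (N + 1) / d * G.degree x := by
  by_contra! hcon
  have hdeg : ∀ v, (0 : ℝ) < G.degree v := fun v => hd.trans_le (hG v)
  set T : ℝ := a ^ (n + 1) with hT
  have hT0 : 0 < T := by positivity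
  set f : V → V → ℝ := fun y z => ∑ q ∈ lists V n,
    (if Admissible G a x (q ++ [z]) y then wt G (q ++ [z]) else 0) with hf
  set Q : V → ℝ := fun z => ∑ q ∈ lists V n, (if IsWalk G x q z then wt G q else 0) with hQ
  have hQ0 : ∀ z, 0 ≤ Q z := fun z =>
    Finset.sum_nonneg fun q _ => by split_ifs <;> simp [wt_nonneg]
  have hQsum : ∑ z, Q z = G.degree x := by
    rw [← sum_walks_from G (fun v => by exact_mod_cast hdeg v) x n, Finset.sum_comm]
  have hf0 : ∀ y z, 0 ≤ f y z := fun y z =>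
    Finset.sum_nonneg fun q _ => by split_ifs <;> simp only [wt_nonneg, le_refl]
  have hfQ : ∀ y z, f y z ≤ if G.Adj z y then Q z / G.degree z else 0 := by
    intro y z
    by_cases h : G.Adj z y
    · rw [if_pos h, hf, hQ]
      simp only [Finset.sum_div]
      refine Finset.sum_le_sum fun q _ => ?_
      by_cases h' : Admissible G a x (q ++ [z]) y
      · rw [if_pos h', if_pos ((isWalk_concat G).1 h'.isWalk).1]
        simp [div_eq_mul_inv]
      · rw [if_neg h']
        have := wt_nonneg G q
        split_ifs <;> positivity
    · rw [if_neg h, hf]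
      exact (Finset.sum_eq_zero fun q _ => if_neg fun h' =>
        h ((isWalk_concat G).1 h'.isWalk).2).le
  set H : Finset V := Finset.univ.filter fun y => ¬ Light G a (n + 1) x y with hH
  set Z₀ : Finset V := Finset.univ.filter fun z => 0 < Q z with hZ₀
  have hfZ₀ : ∀ y, ∑ z ∈ Z₀, f y z = ∑ z, f y z := by
    intro y
    refine Finset.sum_subset (Finset.subset_univ _) fun z _ hz => ?_
    have hz0 : Q z = 0 := by
      simp only [hZ₀, Finset.mem_filter, Finset.mem_univ, true_and, not_lt] at hz
      exact le_antisymm hz (hQ0 z)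
    have := hfQ y z
    rw [hz0] at this
    simp only [zero_div, ite_self] at this
    exact le_antisymm this (hf0 y z)
  have hfsum : ∀ y, ∑ z, f y z =
      ∑ p ∈ lists V (n + 1), (if Admissible G a x p y then wt G p else 0) := by
    intro y
    rw [sum_lists_concat, Finset.sum_comm]
  have hheavy : ∀ y ∈ H, 2 * T < ∑ z, f y z := by
    intro y hy
    simp only [hH, Finset.mem_filter, Finset.mem_univ, true_and, light_iff, not_le] at hy
    rw [hfsum]
    exact hy
  have hW : 2 * (N + 1) / d * G.degree x < ∑ y ∈ H, ∑ z, f y z := by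
    refine hcon.trans_eq ?_
    rw [Finset.sum_comm, hH, Finset.sum_filter]
    refine Finset.sum_congr rfl fun y _ => ?_
    by_cases h : Light G a (n + 1) x y
    · simp [h]
    · simp only [h, not_false_eq_true, and_true, if_true]
      exact (hfsum y).symm
  set c : V → ℝ := fun z => (N + 1) * (Q z / G.degree z) with hc
  have hc0 : ∀ z, 0 ≤ c z := fun z => by
    have := hQ0 z
    have := hdeg z
    positivity
  set Φ : Finset V × Finset V → ℝ := fun P =>
    ∑ y ∈ P.1, (∑ z ∈ P.2, f y z - T) - ∑ z ∈ P.2, c z with hΦ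
  obtain ⟨⟨Y, Z⟩, hYZ, hmax⟩ := Finset.exists_max_image
    ((Finset.univ : Finset (Finset V)) ×ˢ Z₀.powerset) Φ ⟨(∅, ∅), by simp⟩
  have hZZ₀ : Z ⊆ Z₀ := by simpa using hYZ
  have hΦpos : 0 < Φ (Y, Z) := by
    refine lt_of_lt_of_le ?_ (hmax (H, Z₀) (by simp))
    have h1 : ∑ z ∈ Z₀, c z ≤ (N + 1) / d * G.degree x := by
      calc ∑ z ∈ Z₀, c z ≤ ∑ z, c z :=
            Finset.sum_le_sum_of_subset_of_nonneg (Finset.subset_univ _) fun z _ _ => hc0 z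
        _ ≤ ∑ z, (N + 1) / d * Q z := by
            refine Finset.sum_le_sum fun z _ => ?_
            rw [div_mul_eq_mul_div]
            simp only [hc, ← mul_div_assoc]
            have := hQ0 z
            have := hG z
            gcongr
        _ = _ := by rw [← Finset.mul_sum, hQsum]
    have h2 : ∑ y ∈ H, (∑ z, f y z) / 2 ≤ ∑ y ∈ H, (∑ z ∈ Z₀, f y z - T) := by
      refine Finset.sum_le_sum fun y hy => ?_
      have := hheavy y hy
      rw [hfZ₀]
      linarith
    rw [← Finset.sum_div] at h2
    have h3 : 2 * (N + 1) / d * G.degree x = 2 * ((N + 1) / d * G.degree x) := by ring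
    simp only [hΦ]
    linarith
  have hYmem : ∀ y ∈ Y, T ≤ ∑ z ∈ Z, f y z := by
    intro y hy
    have := hmax (Y.erase y, Z) (by simpa using hZZ₀)
    simp only [hΦ] at this
    rw [← Finset.add_sum_erase Y _ hy] at this
    linarith
  have hZmem : ∀ z ∈ Z, N + 1 ≤ (Y.filter fun y => G.Adj z y).card := by
    intro z hz
    have hle := hmax (Y, Z.erase z) (by
      simpa using (Finset.erase_subset z Z).trans hZZ₀)
    simp only [hΦ, Finset.sum_sub_distrib] at hle
    rw [← Finset.add_sum_erase Z c hz,
      Finset.sum_congr rfl fun y _ => (Finset.add_sum_erase Z (f y) hz).symm,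
      Finset.sum_add_distrib] at hle
    have h1 : c z ≤ ∑ y ∈ Y, f y z := by linarith
    have h2 : ∑ y ∈ Y, f y z ≤
        ((Y.filter fun y => G.Adj z y).card : ℝ) * (Q z / G.degree z) := by
      refine (Finset.sum_le_sum fun y _ => hfQ y z).trans ?_
      rw [← Finset.sum_filter, Finset.sum_const, nsmul_eq_mul]
    have h3 : 0 < Q z / G.degree z := by
      have := hZZ₀ hz
      simp only [hZ₀, Finset.mem_filter, Finset.mem_univ, true_and] at this
      exact div_pos this (hdeg z)
    have h4 := le_of_mul_le_mul_right (h1.trans h2) h3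
    exact_mod_cast h4
  have hpath : ∀ y ∈ Y, ∀ S : Finset V, S.card ≤ N → ∃ p ∈ lists V (n + 1),
      Admissible G a x p y ∧ (∃ q, ∃ z ∈ Z, p = q ++ [z]) ∧ ∀ v ∈ p, v ∉ S := by
    intro y hy S hS
    refine exists_admissible_avoiding ha hd hG had hn x y (fun p => ∃ q, ∃ z ∈ Z, p = q ++ [z])
      ((hYmem y hy).trans (le_of_eq ?_)) S hS
    rw [sum_lists_concat, Finset.sum_comm]
    refine Finset.sum_congr rfl fun q _ => ?_
    have hR : ∀ v, (∃ q', ∃ z ∈ Z, q ++ [v] = q' ++ [z]) ↔ v ∈ Z := by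
      intro v
      constructor
      · rintro ⟨q', z, hz, h⟩
        have := (List.append_inj' h rfl).2
        simp only [List.cons.injEq, and_true] at this
        rwa [this]
      · exact fun hv => ⟨q, v, hv, rfl⟩
    simp only [hR, and_comm (b := _ ∈ Z), ite_and]
    simp
  have hlink : ∀ y ∈ Y, Linked G N (n + 1) x y := by
    intro y hy S hS
    obtain ⟨p, hp, h, _, hpS⟩ := hpath y hy S hS
    exact ⟨p, mem_lists.1 hp, h.isWalk, h.nodup, hpS⟩
  have hYZadj : ∀ y ∈ Y, ∀ S : Finset V, S.card ≤ N → ∃ z ∈ Z, G.Adj z y ∧ z ∉ S := by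
    intro y hy S hS
    obtain ⟨p, hp, h, ⟨q, z, hz, rfl⟩, hpS⟩ := hpath y hy S hS
    exact ⟨z, hz, ((isWalk_concat G).1 h.isWalk).2, hpS z (by simp)⟩
  have hZYadj : ∀ z ∈ Z, ∀ S : Finset V, S.card ≤ N → ∃ y ∈ Y, G.Adj y z ∧ y ∉ S := by
    intro z hz S hS
    obtain ⟨y, hy, hyS⟩ := Finset.exists_mem_notMem_of_card_lt_card
      (lt_of_le_of_lt hS (hZmem z hz))
    rw [Finset.mem_filter] at hy
    exact ⟨y, hy.1, hy.2.symm, hyS⟩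
  obtain ⟨y, hy⟩ : Y.Nonempty := by
    by_contra! hY
    have : 0 ≤ ∑ z ∈ Z, c z := Finset.sum_nonneg fun z _ => hc0 z
    simp only [hΦ, hY, Finset.sum_empty] at hΦpos
    linarith
  obtain ⟨p, -, hadm, -, -⟩ := hpath y hy ∅ (by simp)
  have hyx : y ≠ x := by
    rintro rfl
    simpa using hadm.nodup
  obtain ⟨z, hz, -, hzx⟩ := hYZadj y hy {x} (by simp; omega)
  obtain ⟨m, rfl⟩ : ∃ m, K = n + 1 + m := ⟨K - (n + 1), by omega⟩
  have hext := Linked.extend (G := G) (N := N) (M := M) (n := n + 1) (x := x)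
    (A := fun m => if Even m then Y else Z) (by simpa using hlink) (by
      intro m u hu
      by_cases hm : Even m
      · have : ¬ Even (m + 1) := by simpa [Nat.even_add_one] using hm
        simp only [this, if_false] at hu
        simpa only [hm, if_true] using hZYadj u hu
      · have : Even (m + 1) := by simpa [Nat.even_add_one] using hm
        simp only [this, if_true] at hu
        simpa only [hm, if_false] using hYZadj u hu) m (by omega)
  by_cases hm : Even m
  · exact hfree y hyx (hext y (by simpa [hm] using hy) hyx)
  · exact hfree z (by simpa using hzx) (hext z (by simpa [hm] using hz) (by simpa using hzx))

variable (G) in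
/-- Total weight of the walks with `n` internal vertices satisfying `P`. -/
noncomputable def walkSum (n : ℕ) (P : V → List V → V → Prop) : ℝ :=
  ∑ x : V, ∑ p ∈ lists V n, ∑ y : V, (if IsWalk G x p y ∧ P x p y then wt G p else 0)

lemma walkSum_le_add {n : ℕ} {P Q R : V → List V → V → Prop}
    (h : ∀ x p y, p.length = n → IsWalk G x p y → P x p y → Q x p y ∨ R x p y) :
    walkSum G n P ≤ walkSum G n Q + walkSum G n R := by
  simp only [walkSum, ← Finset.sum_add_distrib]
  refine Finset.sum_le_sum fun x _ => Finset.sum_le_sum fun p hp => Finset.sum_le_sum fun y _ => ?_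
  have h0 := wt_nonneg G p
  have h1 := h x p y (mem_lists.1 hp)
  by_cases hw : IsWalk G x p y
  · by_cases hP : P x p y
    · rcases h1 hw hP with h2 | h2
      · simp only [hw, hP, h2, and_self, true_and, if_true]
        split_ifs <;> linarith
      · simp only [hw, hP, h2, and_self, true_and, if_true]
        split_ifs <;> linarith
    · simp only [hw, hP, and_false, if_false, true_and]
      split_ifs <;> linarith
  · simp [hw]

lemma walkSum_true (hG : ∀ v, 0 < G.degree v) (n : ℕ) :
    walkSum G n (fun _ _ _ => True) = ∑ v, (G.degree v : ℝ) := by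
  simp only [walkSum, and_true, sum_walks_from G hG]

lemma walkSum_init (hG : ∀ v, 0 < G.degree v) (n : ℕ) (P : V → List V → V → Prop) :
    walkSum G (n + 1) (fun x p _ => ∃ q z, p = q ++ [z] ∧ P x q z) = walkSum G n P := by
  refine Finset.sum_congr rfl fun x _ => ?_
  rw [sum_lists_concat]
  refine Finset.sum_congr rfl fun q _ => Finset.sum_congr rfl fun z _ => ?_
  have hiff : (∃ q' z', q ++ [z] = q' ++ [z'] ∧ P x q' z') ↔ P x q z := by
    constructor
    · rintro ⟨q', z', h, hP⟩
      obtain ⟨rfl, h'⟩ := List.append_inj' h rfl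
      obtain rfl : z = z' := by simpa using h'
      exact hP
    · exact fun h => ⟨q, z, rfl, h⟩
  have : (G.degree z : ℝ) ≠ 0 := by exact_mod_cast (hG z).ne'
  simp only [hiff]
  by_cases h : IsWalk G x q z ∧ P x q z
  · simp only [isWalk_concat, h.1, h.2, true_and, and_true, if_true, sum_adj_const]
    simp
    field_simp
  · rw [if_neg h]
    exact Finset.sum_eq_zero fun y _ => if_neg fun h' => h ⟨((isWalk_concat G).1 h'.1).1, h'.2⟩

lemma walkSum_tail (hG : ∀ v, 0 < G.degree v) (n : ℕ) (P : V → List V → V → Prop) :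
    walkSum G (n + 1) (fun _ p y => ∃ z r, p = z :: r ∧ P z r y) = walkSum G n P := by
  simp only [walkSum, sum_lists_cons]
  rw [Finset.sum_comm]
  refine Finset.sum_congr rfl fun z _ => ?_
  rw [Finset.sum_comm]
  refine Finset.sum_congr rfl fun r _ => ?_
  rw [Finset.sum_comm]
  refine Finset.sum_congr rfl fun y _ => ?_
  have hiff : (∃ z' r', z :: r = z' :: r' ∧ P z' r' y) ↔ P z r y := by
    constructor
    · rintro ⟨z', r', h, hP⟩
      obtain ⟨rfl, rfl⟩ := List.cons.inj h
      exact hP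
    · exact fun h => ⟨z, r, rfl, h⟩
  have : (G.degree z : ℝ) ≠ 0 := by exact_mod_cast (hG z).ne'
  simp only [hiff]
  by_cases h : IsWalk G z r y ∧ P z r y
  · simp only [isWalk_cons, h.1, h.2, and_true, if_true, G.adj_comm _ z, sum_adj_const]
    simp
    field_simp
  · rw [if_neg h]
    exact Finset.sum_eq_zero fun y _ => if_neg fun h' => h ⟨((isWalk_cons G).1 h'.1).2, h'.2⟩

lemma walkSum_closed_le {d : ℝ} (hd : 0 < d) (hG : ∀ v, d ≤ G.degree v) (n : ℕ) :
    walkSum G (n + 1) (fun x _ y => x = y) ≤ 1 / d * ∑ v, (G.degree v : ℝ) := by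
  have hG' : ∀ v, 0 < G.degree v := fun v => by exact_mod_cast hd.trans_le (hG v)
  rw [← walkSum_true hG' n, walkSum, walkSum, Finset.mul_sum]
  refine Finset.sum_le_sum fun x _ => ?_
  rw [sum_lists_concat, Finset.mul_sum]
  refine Finset.sum_le_sum fun q _ => ?_
  rw [Finset.mul_sum]
  refine Finset.sum_le_sum fun z _ => ?_
  rw [Finset.sum_eq_single x (fun y _ hy => if_neg fun h => hy h.2.symm) (by simp)]
  simp only [and_true]
  have h0 := wt_nonneg G q
  by_cases h : IsWalk G x (q ++ [z]) x
  · rw [if_pos h, if_pos ((isWalk_concat G).1 h).1, one_div, mul_comm]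
    have := hG z
    simp only [wt_append, wt_cons, wt_nil, mul_one]
    gcongr
  · rw [if_neg h]
    split_ifs <;> positivity

lemma admissible_of_init_of_tail {a : ℝ} {x y : V} {p : List V} (hp : p ≠ [])
    (hw : IsWalk G x p y) (hxy : x ≠ y)
    (hinit : ∀ q z, p = q ++ [z] → Admissible G a x q z ∧ Light G a q.length x z)
    (htail : ∀ z r, p = z :: r → Admissible G a z r y ∧ Light G a r.length z y) :
    Admissible G a x p y where
  isWalk := hw
  nodup := by
    obtain ⟨q, z, rfl⟩ : ∃ q z, p = q ++ [z] :=
      (List.eq_nil_or_concat p).resolve_left hp |>.imp fun q => .imp fun z h => by simpa using h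
    have h1 := (hinit q z rfl).1.nodup
    rcases hc : q ++ [z] with _ | ⟨v, r⟩
    · simp at hc
    have h2 := (htail v r hc).1.nodup
    rw [hc] at h1
    rw [← List.cons_append] at h2
    rw [List.nodup_cons] at h1 ⊢
    refine ⟨?_, h2⟩
    simp only [List.mem_append, List.mem_singleton, not_or]
    exact ⟨h1.1, hxy⟩
  light b q c h hl := by
    have key : ∀ {x' y' : V} {p' : List V}, Admissible G a x' p' y' ∧ Light G a p'.length x' y' →
        (b :: (q ++ [c])) <:+: (x' :: (p' ++ [y'])) → Light G a q.length b c := by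
      intro x' y' p' h' hi
      have hle := hi.length_le
      simp only [List.length_cons, List.length_append, List.length_nil] at hle
      rcases (show q.length ≤ p'.length by omega).lt_or_eq with hlt | heq
      · exact h'.1.light b q c hi hlt
      · have := hi.eq_of_length (by simp [heq])
        simp only [List.cons.injEq] at this
        obtain ⟨rfl, h2⟩ := this
        obtain ⟨rfl, h3⟩ := List.append_inj' h2 rfl
        obtain rfl : c = y' := by simpa using h3
        exact h'.2
    rcases infix_walk h with ⟨rfl, rfl, rfl⟩ | ⟨p', z, hp', hi⟩ | ⟨z, p', hp', hi⟩
    · exact absurd hl (lt_irrefl _)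
    · exact key (hinit p' z hp') hi
    · exact key (htail z p' hp') hi

variable (G) in
/-- Admissible paths with a light pair of ends. -/
def Good (a : ℝ) (x : V) (p : List V) (y : V) : Prop :=
  Admissible G a x p y ∧ Light G a p.length x y

lemma walkSum_not_admissible_le {a d : ℝ} (hd : 0 < d) (hG : ∀ v, d ≤ G.degree v) (n : ℕ) :
    walkSum G (n + 1) (fun x p y => ¬ Admissible G a x p y) ≤
      2 * walkSum G n (fun x p y => ¬ Good G a x p y) + 1 / d * ∑ v, (G.degree v : ℝ) := by
  have hG' : ∀ v, 0 < G.degree v := fun v => by exact_mod_cast hd.trans_le (hG v)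
  have h1 : walkSum G (n + 1) (fun x p y => ¬ Admissible G a x p y) ≤
      walkSum G (n + 1) (fun x p _ => ∃ q z, p = q ++ [z] ∧ ¬ Good G a x q z) +
      walkSum G (n + 1) (fun x p y => (∃ z r, p = z :: r ∧ ¬ Good G a z r y) ∨ x = y) := by
    refine walkSum_le_add fun x p y hp hw h => ?_
    by_contra! hcon
    obtain ⟨h1, h2, h3⟩ := hcon
    exact h (admissible_of_init_of_tail (by rintro rfl; simp at hp) hw h3 h1 h2)
  have h2 : walkSum G (n + 1) (fun x p y => (∃ z r, p = z :: r ∧ ¬ Good G a z r y) ∨ x = y) ≤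
      walkSum G (n + 1) (fun _ p y => ∃ z r, p = z :: r ∧ ¬ Good G a z r y) +
      walkSum G (n + 1) (fun x _ y => x = y) :=
    walkSum_le_add fun x p y _ _ h => h
  rw [walkSum_init hG' n (fun x q z => ¬ Good G a x q z)] at h1
  rw [walkSum_tail hG' n (fun z r y => ¬ Good G a z r y)] at h2
  linarith [walkSum_closed_le hd hG n]

lemma good_nil {a : ℝ} {x y : V} (h : IsWalk G x [] y) : Good G a x [] y := by
  have hne : x ≠ y := by
    have : G.Adj x y := by simpa [IsWalk] using h
    exact this.ne
  refine ⟨⟨h, by simpa using hne, fun b q c _ hl => by simp at hl⟩, ?_⟩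
  rw [List.length_nil, light_iff, sum_lists_zero]
  split_ifs <;> norm_num

lemma walkSum_not_good_le {a d : ℝ} {N M K n : ℕ} (ha : 0 < a) (hd : 0 < d)
    (hG : ∀ v, d ≤ G.degree v) (had : 4 * (N * K : ℝ) < a * d) (hn : n ≤ K)
    (hMN : M + K + 2 ≤ N) (hfree : ∀ x y, y ≠ x → ¬ Linked G M K x y) :
    walkSum G n (fun x p y => ¬ Good G a x p y) ≤
      (2 ^ n - 1) * ((2 * N + 3) / d) * ∑ v, (G.degree v : ℝ) := by
  induction n with
  | zero =>
    simp only [pow_zero, sub_self, zero_mul]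
    refine (Finset.sum_eq_zero fun x _ => ?_).le
    rw [sum_lists_zero]
    exact Finset.sum_eq_zero fun y _ => if_neg fun h => h.2 (good_nil h.1)
  | succ n ih =>
    have h1 : walkSum G (n + 1) (fun x p y => ¬ Good G a x p y) ≤
        walkSum G (n + 1) (fun x p y => ¬ Admissible G a x p y) +
        walkSum G (n + 1) (fun x p y => Admissible G a x p y ∧ ¬ Light G a (n + 1) x y) := by
      refine walkSum_le_add fun x p y hp _ h => ?_
      by_contra! hcon
      exact h ⟨hcon.1, hp ▸ hcon.2 hcon.1⟩
    have h2 : walkSum G (n + 1) (fun x p y => Admissible G a x p y ∧ ¬ Light G a (n + 1) x y) ≤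
        2 * (N + 1) / d * ∑ v, (G.degree v : ℝ) := by
      rw [walkSum, Finset.mul_sum]
      refine Finset.sum_le_sum fun x _ =>
        le_trans (le_of_eq ?_) (sum_heavy_le ha hd hG had hn hMN x (hfree x))
      refine Finset.sum_congr rfl fun p _ => Finset.sum_congr rfl fun y _ => ?_
      by_cases h : Admissible G a x p y ∧ ¬ Light G a (n + 1) x y
      · rw [if_pos h, if_pos ⟨h.1.isWalk, h⟩]
      · rw [if_neg h, if_neg fun h' => h h'.2]
    have h3 := walkSum_not_admissible_le (a := a) hd hG n
    have h4 := ih (by omega)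
    calc _ ≤ 2 * ((2 ^ n - 1) * ((2 * N + 3) / d) * ∑ v, (G.degree v : ℝ)) +
          1 / d * ∑ v, (G.degree v : ℝ) + 2 * (N + 1) / d * ∑ v, (G.degree v : ℝ) := by linarith
      _ = _ := by ring

/-- Large minimum degree forces a robustly linked pair of vertices. -/
lemma exists_linked [Nonempty V] {d : ℝ} {N M K : ℕ} (hd : 0 < d)
    (hG : ∀ v, d ≤ G.degree v) (hK : 1 ≤ K) (hMN : M + K + 2 ≤ N)
    (hd1 : 2 ^ (K + 1) * (2 * N + 3) ≤ d)
    (hd2 : 2 * (Fintype.card V : ℝ) * (8 * N * K : ℝ) ^ K < d ^ (K + 1)) :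
    ∃ x y, y ≠ x ∧ Linked G M K x y := by
  by_contra! hfree
  obtain ⟨k, rfl⟩ : ∃ k, K = k + 1 := ⟨K - 1, by omega⟩
  have hG' : ∀ v, 0 < G.degree v := fun v => by exact_mod_cast hd.trans_le (hG v)
  have hN : (0 : ℝ) < N := by exact_mod_cast (by omega : 0 < N)
  set K := k + 1 with hKdef
  have hK0 : (0 : ℝ) < K := by exact_mod_cast hK
  set a : ℝ := 8 * N * K / d with ha_def
  have ha : 0 < a := by positivity
  have had : 4 * (N * K : ℝ) < a * d := by
    rw [ha_def, div_mul_cancel₀ _ hd.ne']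
    have : (0 : ℝ) < N * K := by positivity
    linarith
  set E := ∑ v, (G.degree v : ℝ) with hE
  set n : ℝ := (Fintype.card V : ℝ) with hn
  have hn0 : 0 < n := by
    rw [hn]
    exact_mod_cast Fintype.card_pos
  have hEn : n * d ≤ E := by
    rw [hE, hn, ← nsmul_eq_mul, ← Finset.card_univ]
    exact Finset.card_nsmul_le_sum _ _ _ fun v _ => hG v
  have h1 : E ≤ walkSum G K (fun x p y => ¬ Admissible G a x p y) +
      walkSum G K (fun x p y => Admissible G a x p y) := by
    rw [hE, ← walkSum_true hG' K]
    exact walkSum_le_add fun x p y _ _ _ => (Classical.em _).symm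
  have h2 : walkSum G K (fun x p y => Admissible G a x p y) ≤ n * n * a ^ K := by
    have : ∀ x y, ∑ p ∈ lists V K,
        (if IsWalk G x p y ∧ Admissible G a x p y then wt G p else 0) ≤ a ^ K := by
      intro x y
      by_cases hxy : y = x
      · refine (Finset.sum_eq_zero fun p _ => if_neg ?_).le.trans (by positivity)
        rintro ⟨-, h⟩
        simpa [hxy] using h.nodup
      · by_contra! hlt
        refine hfree x y hxy fun S hS => ?_
        obtain ⟨p, hp, h, -, hpS⟩ := exists_admissible_avoiding (N := N) (k := K) (n := k)
          ha hd hG had le_rfl x y (IsWalk G x · y) (hlt.le.trans (le_of_eq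
            (Finset.sum_congr rfl fun p _ => by
              by_cases h : IsWalk G x p y ∧ Admissible G a x p y
              · rw [if_pos h, if_pos h.symm]
              · rw [if_neg h, if_neg fun h' => h h'.symm]))) S (by omega)
        exact ⟨p, mem_lists.1 hp, h.isWalk, h.nodup, hpS⟩
    calc _ = ∑ x : V, ∑ y : V, ∑ p ∈ lists V K,
          (if IsWalk G x p y ∧ Admissible G a x p y then wt G p else 0) :=
          Finset.sum_congr rfl fun x _ => Finset.sum_comm
      _ ≤ ∑ _x : V, ∑ _y : V, a ^ K :=
          Finset.sum_le_sum fun x _ => Finset.sum_le_sum fun y _ => this x y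
      _ = _ := by
          simp only [Finset.sum_const, Finset.card_univ, nsmul_eq_mul]
          ring
  have h3 := walkSum_not_admissible_le (a := a) hd hG k
  have h4 := walkSum_not_good_le (n := k) ha hd hG had (by omega) hMN fun x y => hfree x y
  have h5 : 2 ^ K * ((2 * N + 3) / d) ≤ 1 / 2 := by
    rw [← mul_div_assoc, div_le_iff₀ hd]
    rw [pow_succ] at hd1
    linarith
  have hE0 : 0 ≤ E := (by positivity : (0 : ℝ) ≤ n * d).trans hEn
  have h6 : walkSum G K (fun x p y => ¬ Admissible G a x p y) ≤ 1 / 2 * E := by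
    have h7 : 1 / d ≤ (2 * N + 3) / d := by gcongr; linarith
    have h8 := mul_le_mul_of_nonneg_right h7 hE0
    have h9 : 0 ≤ (2 * N + 3) / d * E := by positivity
    calc _ ≤ 2 * ((2 ^ k - 1) * ((2 * N + 3) / d) * E) + 1 / d * E := by linarith
      _ ≤ 2 ^ K * ((2 * N + 3) / d) * E := by
          rw [hKdef, pow_succ]
          nlinarith
      _ ≤ _ := by gcongr
  have h7 : n * d ≤ n * (2 * n * a ^ K) := by linarith
  have h8 : d ≤ 2 * n * a ^ K := le_of_mul_le_mul_left h7 hn0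
  rw [ha_def, div_pow, ← mul_div_assoc, le_div_iff₀ (by positivity)] at h8
  rw [pow_succ d] at hd2
  linarith [mul_comm d (d ^ K)]

/-- A theta-free graph has few edges: remove vertices of degree less than `d` one at a time. -/
lemma card_edgeFinset_le_of_free {d : ℝ} {t K n : ℕ} (hd : 0 < d) (ht : 2 ≤ t) (hK : 1 ≤ K)
    (hd1 : 2 ^ (K + 1) * (2 * (3 * t * K : ℕ) + 3) ≤ d)
    (hd2 : 2 * (n : ℝ) * (8 * (3 * t * K : ℕ) * K : ℝ) ^ K < d ^ (K + 1))
    (hn : Fintype.card V ≤ n) (hfree : ¬ G.HasTheta (K + 1) t) :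
    (G.edgeFinset.card : ℝ) ≤ d * Fintype.card V := by
  induction hm : Fintype.card V generalizing V with
  | zero =>
    have := Fintype.card_eq_zero_iff.1 hm
    simp [Finset.eq_empty_of_isEmpty]
  | succ m ih =>
    have hne : Nonempty V := Fintype.card_pos_iff.1 (by omega)
    by_cases hG : ∀ v, d ≤ G.degree v
    · refine absurd ?_ hfree
      have htK : 2 * K ≤ t * K := Nat.mul_le_mul_right K ht
      obtain ⟨x, y, hyx, h⟩ := exists_linked (G := G) (N := 3 * t * K) (M := t * K) (K := K)
        hd hG hK (by rw [mul_assoc]; omega) hd1 (lt_of_le_of_lt (by gcongr) hd2)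
      exact h.hasTheta hyx.symm
    · push Not at hG
      obtain ⟨v, hv⟩ := hG
      have hcard : Fintype.card ({v}ᶜ : Set V) = m := by
        rw [Fintype.card_compl_set, hm]
        simp
      have h1 := ih (V := ({v}ᶜ : Set V)) (G := G.induce {v}ᶜ) (by omega)
        (fun h => hfree (hasTheta_of_induce h)) hcard
      have h2 := G.card_edgeFinset_induce_compl_singleton v
      rw [G.card_edgeFinset_deleteIncidenceSet v] at h2
      have h3 : G.edgeFinset.card ≤ (G.induce {v}ᶜ).edgeFinset.card + G.degree v := by
        have : (G.induce {v}ᶜ).edgeFinset.card = G.edgeFinset.card - G.degree v := by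
          convert h2
        omega
      have h4 : (G.edgeFinset.card : ℝ) ≤ (G.induce {v}ᶜ).edgeFinset.card + G.degree v := by
        exact_mod_cast h3
      calc (G.edgeFinset.card : ℝ) ≤ d * m + d :=
            h4.trans (add_le_add (le_of_eq_of_le (by congr!) h1) hv.le)
        _ = d * (m + 1 : ℕ) := by push_cast; ring

end ThetaTuran

/-- For every `ℓ ≥ 2` there is a constant `C > 0` such that for all `t ≥ 2` and `n ≥ 1`,
every `Θ_{ℓ,t}`-free graph on `n` vertices has at most `C · t^{1-1/ℓ} · n^{1+1/ℓ}` edges. -/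
theorem theta_turan_upper (ℓ : ℕ) (hℓ : 2 ≤ ℓ) :
    ∃ C : ℝ, 0 < C ∧
      ∀ (t n : ℕ), 2 ≤ t → 1 ≤ n →
        ∀ (V : Type) (_ : Fintype V) (G : SimpleGraph V) (_ : DecidableRel G.Adj),
          Fintype.card V = n → ¬ G.HasTheta ℓ t →
          (G.edgeFinset.card : ℝ) ≤
            C * (t : ℝ) ^ (1 - 1 / (ℓ : ℝ)) * (n : ℝ) ^ (1 + 1 / (ℓ : ℝ)) := by
  obtain ⟨K, rfl⟩ : ∃ K, ℓ = K + 1 := ⟨ℓ - 1, by omega⟩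
  have hK : 1 ≤ K := by omega
  have hK' : (1 : ℝ) ≤ K := by exact_mod_cast hK
  set C : ℝ := 2 ^ (K + 1) * (24 * K * K) with hC
  have h2K : (1 : ℝ) ≤ 2 ^ (K + 1) := one_le_pow₀ one_le_two
  have hKK : (K : ℝ) ≤ K * K := by nlinarith
  have hC24 : 24 * K * K ≤ C := by
    rw [hC]
    exact le_mul_of_one_le_left (by positivity) h2K
  have hC2 : 2 < C := by nlinarith
  refine ⟨C, by positivity, ?_⟩
  intro t n ht hn V _ G _ hV hfree
  have ht' : (2 : ℝ) ≤ t := by exact_mod_cast ht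
  have hn' : (1 : ℝ) ≤ n := by exact_mod_cast hn
  have ht0 : (0 : ℝ) < t := by linarith
  have hn0 : (0 : ℝ) < n := by linarith
  set s : ℝ := 1 / ((K + 1 : ℕ) : ℝ) with hs
  have hs0 : 0 < s := by positivity
  have hs1 : s ≤ 1 := by
    rw [hs, div_le_one (by positivity)]
    exact_mod_cast Nat.le_add_left 1 K
  rcases le_total n t with hnt | htn
  · have hnt' : (n : ℝ) ≤ t := by exact_mod_cast hnt
    have h1 : (G.edgeFinset.card : ℝ) ≤ n * n := by
      have h := G.card_edgeFinset_le_card_choose_two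
      rw [hV] at h
      have h' := h.trans (Nat.choose_le_pow n 2)
      rw [← sq]
      exact_mod_cast h'
    calc (G.edgeFinset.card : ℝ) ≤ n * n := h1
      _ = 1 * (n : ℝ) ^ (1 - s) * (n : ℝ) ^ (1 + s) := by
          rw [one_mul, ← Real.rpow_add hn0, ← sq, ← Real.rpow_natCast]
          norm_num
      _ ≤ C * (t : ℝ) ^ (1 - s) * (n : ℝ) ^ (1 + s) := by
          have : 0 ≤ 1 - s := by linarith
          gcongr
          linarith
  · have htn' : (t : ℝ) ≤ n := by exact_mod_cast htn
    set d : ℝ := C * (t : ℝ) ^ (1 - s) * (n : ℝ) ^ s with hd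
    have hd0 : 0 < d := by positivity
    have hdt : C * t ≤ d := by
      have h1 : (t : ℝ) = (t : ℝ) ^ (1 - s) * (t : ℝ) ^ s := by
        rw [← Real.rpow_add ht0]
        norm_num
      have h2 : C * (t : ℝ) ^ (1 - s) * (t : ℝ) ^ s ≤ d := by
        rw [hd]
        gcongr
      rwa [mul_assoc, ← h1] at h2
    have hdpow : d ^ (K + 1) = C ^ (K + 1) * (t : ℝ) ^ K * n := by
      have hsK : s * ((K + 1 : ℕ) : ℝ) = 1 := by
        rw [hs]
        field_simp
      have hsK' : (1 - s) * ((K + 1 : ℕ) : ℝ) = K := by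
        rw [sub_mul, hsK]
        push_cast
        ring
      rw [hd, mul_pow, mul_pow, ← Real.rpow_mul_natCast ht0.le, ← Real.rpow_mul_natCast hn0.le,
        hsK, hsK', Real.rpow_natCast, Real.rpow_one]
    have hd1 : 2 ^ (K + 1) * (2 * (3 * t * K : ℕ) + 3) ≤ d := by
      have h1 : (t : ℝ) * K ≤ K * K * t := by nlinarith
      have h2 : (1 : ℝ) ≤ t * K := by nlinarith
      have h3 : 2 * ((3 * t * K : ℕ) : ℝ) + 3 ≤ 24 * K * K * t := by
        push_cast
        linarith
      calc (2 : ℝ) ^ (K + 1) * (2 * (3 * t * K : ℕ) + 3)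
          ≤ 2 ^ (K + 1) * (24 * K * K * t) := by gcongr
        _ = C * t := by rw [hC]; ring
        _ ≤ d := hdt
    have hd2 : 2 * (n : ℝ) * (8 * (3 * t * K : ℕ) * K : ℝ) ^ K < d ^ (K + 1) := by
      rw [hdpow]
      push_cast
      calc 2 * (n : ℝ) * (8 * (3 * t * K) * K) ^ K
          = 2 * ((24 * K * K : ℝ) ^ K * (t : ℝ) ^ K * n) := by
            rw [← mul_pow]
            ring
        _ < C * ((24 * K * K : ℝ) ^ K * (t : ℝ) ^ K * n) := by gcongr
        _ ≤ C * (C ^ K * (t : ℝ) ^ K * n) := by gcongr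
        _ = _ := by ring
    have h := ThetaTuran.card_edgeFinset_le_of_free (G := G) hd0 ht hK hd1 hd2 hV.le hfree
    rw [hV] at h
    calc (G.edgeFinset.card : ℝ) ≤ d * n := by convert h
      _ = _ := by
        rw [hd, add_comm, Real.rpow_add hn0, Real.rpow_one]
        ring
end

section
/- For every fixed odd integer ℓ ≥ 3 there exist a constant c = c(ℓ) > 0 and an integer t_0 = t_0(ℓ) such that for every integer t ≥ t_0 there is an integer n_0 = n_0(ℓ, t) with the following property: for every n ≥ n_0 there exists a Θ_{ℓ,t}-free graph on n vertices with at least c · t^{1−1/ℓ} · n^{1+1/ℓ} edges. -/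
/-- A finite set has at least as many elements as any algebraically independent family contained
in the field it generates. -/
theorem AlgebraicIndependent.card_le_of_mem_adjoin {k Ω ι : Type*} [Field k] [Field Ω]
    [Algebra k Ω] [Fintype ι] {x : ι → Ω} (hx : AlgebraicIndependent k x) (S : Finset Ω)
    (h : ∀ i, x i ∈ IntermediateField.adjoin k (S : Set Ω)) : Fintype.card ι ≤ S.card := by
  have hI : (AlgebraicIndependent.matroid k Ω).Indep (Set.range x) := hx.coe_range
  have hsub : Set.range x ⊆ (AlgebraicIndependent.matroid k Ω).closure (S : Set Ω) := by
    rw [AlgebraicIndependent.matroid_closure_eq]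
    rintro _ ⟨i, rfl⟩
    obtain ⟨a, ha, b, hb, hab⟩ := IntermediateField.mem_adjoin_iff_div.1 (h i)
    rw [SetLike.mem_coe, Subalgebra.mem_algebraicClosure, hab, div_eq_mul_inv]
    exact (isAlgebraic_algebraMap (⟨a, ha⟩ : Algebra.adjoin k (S : Set Ω))).mul
      (isAlgebraic_algebraMap (⟨b, hb⟩ : Algebra.adjoin k (S : Set Ω))).inv
  have h1 := hI.encard_le_eRk_of_subset hsub
  rw [Matroid.eRk_closure_eq] at h1
  have h2 := h1.trans (Matroid.eRk_le_encard _ _)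
  rw [Set.encard_coe_eq_coe_finsetCard, ← Set.image_univ, hx.injective.encard_image,
    Set.encard_univ, ENat.card_eq_coe_fintype_card] at h2
  exact_mod_cast h2

/-- A linear system with independent rows can be solved over any subfield containing its
coefficients, the unknowns outside a fixed set of pivot columns being free. -/
theorem LinearIndependent.exists_pivots {Ω E A : Type*} [Field Ω] [Fintype E]
    [Fintype A] [DecidableEq A] {M : E → A → Ω} (hM : LinearIndependent Ω M) :
    ∃ J : Finset A, J.card = Fintype.card E ∧ ∀ K : Subfield Ω, (∀ e a, M e a ∈ K) →
      ∀ c : A → Ω, (∀ e, ∑ a, c a * M e a ∈ K) → (∀ a ∉ J, c a ∈ K) → ∀ a, c a ∈ K := by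
  classical
  obtain ⟨κ, f, hf, hspan, hli⟩ := exists_linearIndependent' Ω (fun a e => M e a)
  have htop : Submodule.span Ω (Set.range fun a e => M e a) = ⊤ := by
    have h1 : (Matrix.of M).rank = Fintype.card E := LinearIndependent.rank_matrix hM
    rw [Matrix.rank_eq_finrank_span_cols] at h1
    apply Submodule.eq_top_of_finrank_eq
    rw [Module.finrank_fintype_fun_eq_card, ← h1]
    rfl
  have : Finite κ := Finite.of_injective f hf
  have := Fintype.ofFinite κ
  let b := Module.Basis.mk hli (by rw [hspan, htop])
  have hcard : Fintype.card κ = Fintype.card E := by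
    rw [← Module.finrank_eq_card_basis b, Module.finrank_fintype_fun_eq_card]
  let σ : E ≃ κ := Fintype.equivOfCardEq hcard.symm
  refine ⟨Finset.univ.map ⟨f, hf⟩, by simpa using hcard, fun K hK c hc hJ a => ?_⟩
  by_cases haJ : a ∈ Finset.univ.map ⟨f, hf⟩
  swap
  · exact hJ a haJ
  let B : Matrix E E K := Matrix.of fun e e' => ⟨M e (f (σ e')), hK _ _⟩
  have hdet : IsUnit B.det := by
    rw [isUnit_iff_ne_zero]
    intro h0
    have h1 : (B.map K.subtype).det = 0 := by
      have := RingHom.map_det K.subtype B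
      rw [h0, map_zero] at this
      exact this.symm
    have h2 : LinearIndependent Ω (B.map K.subtype).col := by
      have := hli.comp σ σ.injective
      exact this
    rw [Matrix.linearIndependent_cols_iff_isUnit, Matrix.isUnit_iff_isUnit_det, h1] at h2
    exact not_isUnit_zero h2
  have hsplit : ∀ e, ∑ e', M e (f (σ e')) * c (f (σ e')) ∈ K := by
    intro e
    have h1 := hc e
    rw [← Finset.sum_add_sum_compl (Finset.univ.map ⟨f, hf⟩)] at h1
    have h2 : ∑ a ∈ (Finset.univ.map ⟨f, hf⟩)ᶜ, c a * M e a ∈ K :=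
      K.sum_mem fun a ha => K.mul_mem (hJ a (Finset.mem_compl.1 ha)) (hK _ _)
    have h3 := K.sub_mem h1 h2
    rw [add_sub_cancel_right, Finset.sum_map] at h3
    rw [← σ.sum_comp] at h3
    simpa [mul_comm] using h3
  let r : E → K := fun e => ⟨_, hsplit e⟩
  have hsol : (fun e => c (f (σ e))) = fun e => ((B⁻¹).mulVec r e : Ω) := by
    have h1 : (B.map K.subtype).mulVec (fun e => c (f (σ e))) = K.subtype ∘ r := by
      ext e; rfl
    have h2 : (B⁻¹.map K.subtype).mulVec ((B.map K.subtype).mulVec (fun e => c (f (σ e))))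
        = fun e => c (f (σ e)) := by
      rw [Matrix.mulVec_mulVec, ← Matrix.map_mul, Matrix.nonsing_inv_mul _ hdet]
      simp
    rw [← h2, h1]
    ext e
    exact (RingHom.map_mulVec K.subtype B⁻¹ r e).symm
  obtain ⟨z, -, rfl⟩ := Finset.mem_map.1 haJ
  have := congrFun hsol (σ.symm z)
  simp only [Equiv.apply_symm_apply] at this
  change c (f z) ∈ K
  rw [this]
  exact SetLike.coe_mem _

/-- Evaluations of monomials of bounded degree at distinct points are linearly independent. -/
theorem linearIndependent_monomials_eval {Ω E V : Type*} [Field Ω] [Fintype E] [Fintype V]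
    [Nonempty V] {P : E → V → Ω} (hP : Function.Injective P) {r : ℕ} (hr : Fintype.card E ≤ r) :
    LinearIndependent Ω fun (e : E) (α : V → Fin r) => ∏ v, P e v ^ (α v : ℕ) := by
  classical
  rw [Fintype.linearIndependent_iff]
  intro g hg e₀
  have hpoly : ∀ q : MvPolynomial V Ω, q.totalDegree < r →
      ∑ e, g e * MvPolynomial.eval (P e) q = 0 := by
    intro q hq
    simp_rw [MvPolynomial.eval_eq', Finset.mul_sum]
    rw [Finset.sum_comm]
    refine Finset.sum_eq_zero fun d hd => ?_
    have hd' : ∀ v, d v < r := fun v => by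
      refine lt_of_le_of_lt ?_ hq
      exact (MvPolynomial.monomial_le_degreeOf v hd).trans (MvPolynomial.degreeOf_le_totalDegree _ _)
    have := congrFun hg fun v => ⟨d v, hd' v⟩
    simp only [Finset.sum_apply, Pi.smul_apply, smul_eq_mul, Pi.zero_apply] at this
    calc _ = q.coeff d * ∑ e, g e * ∏ v, P e v ^ d v := by
          rw [Finset.mul_sum]; exact Finset.sum_congr rfl fun e _ => by ring
      _ = 0 := by rw [this, mul_zero]
  have hne : ∀ e, e ≠ e₀ → ∃ v, P e v ≠ P e₀ v := fun e he => by
    by_contra! h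
    exact he (hP (funext h))
  choose! v hv using hne
  let q : MvPolynomial V Ω := ∏ e ∈ Finset.univ.erase e₀,
    (MvPolynomial.X (v e) - MvPolynomial.C (P e (v e)))
  have hq : q.totalDegree < r := by
    have h1 : q.totalDegree ≤ ∑ e ∈ Finset.univ.erase e₀, 1 := by
      refine (MvPolynomial.totalDegree_finsetProd _ _).trans (Finset.sum_le_sum fun e _ => ?_)
      refine (MvPolynomial.totalDegree_sub_C_le _ _).trans ?_
      simp
    have h2 : (Finset.univ.erase e₀).card < Fintype.card E :=
      Finset.card_lt_card (Finset.erase_ssubset (Finset.mem_univ _))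
    simp at h1 h2
    omega
  have h1 := hpoly q hq
  rw [Finset.sum_eq_single e₀] at h1
  · refine (mul_eq_zero.1 h1).resolve_right ?_
    simp only [q, map_prod, map_sub, MvPolynomial.eval_X, MvPolynomial.eval_C]
    exact Finset.prod_ne_zero_iff.2 fun e he => sub_ne_zero.2 (hv e (Finset.ne_of_mem_erase he)).symm
  · intro e _ he
    simp only [q, map_prod, map_sub, MvPolynomial.eval_X, MvPolynomial.eval_C]
    rw [Finset.prod_eq_zero (Finset.mem_erase.2 ⟨he, Finset.mem_univ e⟩) (sub_self _), mul_zero]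
  · simp

open Finset in
/-- A walk visits at most one more vertex than it uses edges. -/
theorem card_image_walk_le {α β : Type*} [DecidableEq α] [DecidableEq β] (W : ℕ → α) (e : ℕ → β)
    (h : ∀ i n, i < n → e i = e n → W (n + 1) = W i ∨ W (n + 1) = W (i + 1)) (n : ℕ) :
    #((range (n + 1)).image W) ≤ #((range n).image e) + 1 := by
  induction n with
  | zero => simp
  | succ n ih =>
    rw [range_add_one (n := n + 1), image_insert]
    by_cases hW : W (n + 1) ∈ (range (n + 1)).image W
    · rw [insert_eq_of_mem hW]
      exact ih.trans (Nat.add_le_add_right (card_le_card (image_subset_image (by simp))) 1)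
    · have he : e n ∉ (range n).image e := by
        intro he
        obtain ⟨i, hi, hin⟩ := mem_image.1 he
        rw [mem_range] at hi
        refine hW ?_
        rcases h i n hi hin with h | h <;> rw [h] <;> refine mem_image_of_mem _ (mem_range.2 ?_) <;>
          omega
      have he' : #((range (n + 1)).image e) = #((range n).image e) + 1 := by
        rw [range_add_one, image_insert, card_insert_of_notMem he]
      rw [card_insert_of_notMem hW, he']
      omega

/-- Coefficients of `m` polynomials in `m + 2` variables with degree less than `r` in each
variable. -/
abbrev PolyCoeffs (m r : ℕ) : Type := Fin m × (Fin (m + 2) → Fin r)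

/-- The point `a` and the line `b` are incident: all coordinates of `b` but the first are
the values of the polynomials with coefficients `c` at the point `(b 0, a)`. -/
def PolyIncident {F : Type*} [CommRing F] {m r : ℕ} (c : PolyCoeffs m r → F)
    (a b : Fin (m + 1) → F) : Prop :=
  ∀ i : Fin m, b i.succ =
    ∑ α : Fin (m + 2) → Fin r, c (i, α) * ∏ v, (Fin.cons (b 0) a : Fin (m + 2) → F) v ^ (α v : ℕ)

/-- The point of the `i`-th edge of a walk that starts in a point. -/
def walkPoint {V : Type*} (w : ℕ → V) (i : ℕ) : V := if Even i then w i else w (i + 1)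

/-- The line of the `i`-th edge of a walk that starts in a point. -/
def walkLine {V : Type*} (w : ℕ → V) (i : ℕ) : V := if Even i then w (i + 1) else w i

/-- A family of internally disjoint walks of length `ℓ` from the point `x` to the line `y` in the
incidence graph given by `c`, the interiors of which avoid `x` and `y`. -/
structure IsWalkFamily {F ι : Type*} [CommRing F] {m r : ℕ} (ℓ : ℕ) (c : PolyCoeffs m r → F)
    (x y : Fin (m + 1) → F) (w : ι → ℕ → Fin (m + 1) → F) : Prop where
  start : ∀ j, w j 0 = x
  finish : ∀ j, w j ℓ = y
  incident : ∀ j, ∀ i < ℓ, PolyIncident c (walkPoint (w j) i) (walkLine (w j) i)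
  ne_start : ∀ j i, 0 < i → i < ℓ → Even i → w j i ≠ x
  ne_finish : ∀ j i, 0 < i → i < ℓ → ¬ Even i → w j i ≠ y
  disjoint : ∀ j j', j ≠ j' → ∀ i i', 0 < i → i < ℓ → 0 < i' → i' < ℓ → (Even i ↔ Even i') →
    w j i ≠ w j' i'

namespace IsWalkFamily

/-- The vertices of the walks, tagged by `true` for points and by `false` for lines. -/
def vertices {F ι : Type*} {m : ℕ} [DecidableEq F] [Fintype ι] (ℓ : ℕ) (w : ι → ℕ → Fin (m + 1) → F) :
    Finset (Bool × (Fin (m + 1) → F)) :=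
  Finset.univ.biUnion fun j => (Finset.range (ℓ + 1)).image fun i => (decide (Even i), w j i)

/-- The edges of the walks, as pairs of a point and a line. -/
def edges {F ι : Type*} {m : ℕ} [DecidableEq F] [Fintype ι] (ℓ : ℕ) (w : ι → ℕ → Fin (m + 1) → F) :
    Finset ((Fin (m + 1) → F) × (Fin (m + 1) → F)) :=
  Finset.univ.biUnion fun j => (Finset.range ℓ).image fun i => (walkPoint (w j) i, walkLine (w j) i)

theorem card_edges_le {F ι : Type*} {m : ℕ} [DecidableEq F] [Fintype ι] (ℓ : ℕ)
    (w : ι → ℕ → Fin (m + 1) → F) : (edges ℓ w).card ≤ Fintype.card ι * ℓ := by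
  refine Finset.card_biUnion_le_card_mul _ _ _ fun j _ => ?_
  exact Finset.card_image_le.trans (by simp)

variable {F ι : Type*} [CommRing F] {m r ℓ : ℕ} {c : PolyCoeffs m r → F}
  {x y : Fin (m + 1) → F} {w : ι → ℕ → Fin (m + 1) → F}

theorem eq_of_meet (h : IsWalkFamily ℓ c x y w) (hℓ : ¬ Even ℓ) {j j' : ι} {i i' : ℕ}
    (hi : 0 < i) (hi' : i < ℓ) (hi'' : i' ≤ ℓ) (hp : Even i ↔ Even i') (he : w j i = w j' i') :
    j = j' := by
  by_contra hj
  rcases Nat.eq_zero_or_pos i' with rfl | h0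
  · exact h.ne_start j i hi hi' (hp.2 (by simp)) (he.trans (h.start j'))
  rcases hi''.eq_or_lt with rfl | h1
  · exact h.ne_finish j i hi hi' (fun h => hℓ (hp.1 h)) (he.trans (h.finish j'))
  · exact h.disjoint j j' hj i i' hi hi' h0 h1 hp he

theorem eq_of_common_edge (h : IsWalkFamily ℓ c x y w) (hℓ : ¬ Even ℓ) (hℓ1 : 1 < ℓ) {j j' : ι}
    {i i' : ℕ} (hi : i < ℓ) (hi' : i' < ℓ) (ha : walkPoint (w j) i = walkPoint (w j') i')
    (hb : walkLine (w j) i = walkLine (w j') i') : j = j' := by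
  have key : ∀ k, k = i ∨ k = i + 1 → ∃ k' ≤ ℓ, (Even k ↔ Even k') ∧ w j k = w j' k' := by
    unfold walkPoint walkLine at *
    rintro k (rfl | rfl)
    · by_cases hk : Even k <;> by_cases hk' : Even i' <;>
        simp only [hk, hk', if_true, if_false] at ha hb
      · exact ⟨i', by omega, by simp [hk, hk'], ha⟩
      · exact ⟨i' + 1, by omega, by simp [hk, hk', Nat.even_add_one], ha⟩
      · exact ⟨i' + 1, by omega, by simp [hk, hk', Nat.even_add_one], hb⟩
      · exact ⟨i', by omega, by simp [hk, hk'], hb⟩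
    · by_cases hk : Even i <;> by_cases hk' : Even i' <;>
        simp only [hk, hk', if_true, if_false] at ha hb
      · exact ⟨i' + 1, by omega, by simp [hk, hk', Nat.even_add_one], hb⟩
      · exact ⟨i', by omega, by simp [hk, hk', Nat.even_add_one], hb⟩
      · exact ⟨i', by omega, by simp [hk, hk', Nat.even_add_one], ha⟩
      · exact ⟨i' + 1, by omega, by simp [hk, hk', Nat.even_add_one], ha⟩
  by_cases h0 : i = 0
  · obtain ⟨k', h1, h2, h3⟩ := key (i + 1) (Or.inr rfl)
    exact h.eq_of_meet hℓ (by omega) (by omega) h1 h2 h3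
  · obtain ⟨k', h1, h2, h3⟩ := key i (Or.inl rfl)
    exact h.eq_of_meet hℓ (by omega) (by omega) h1 h2 h3

open Finset in
/-- The number of vertices in a walk family is bounded in terms of the number of edges. -/
theorem card_vertices_le [DecidableEq F] [Fintype ι] (h : IsWalkFamily ℓ c x y w)
    (hℓ : ¬ Even ℓ) (hℓ1 : 1 < ℓ) :
    ℓ * #(vertices ℓ w) ≤ 2 * ℓ + (ℓ - 1) * #(edges ℓ w) := by
  classical
  set W : ι → ℕ → Bool × (Fin (m + 1) → F) := fun j i => (decide (Even i), w j i) with hW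
  set e : ι → ℕ → (Fin (m + 1) → F) × (Fin (m + 1) → F) :=
    fun j i => (walkPoint (w j) i, walkLine (w j) i) with he
  set I : ι → Finset (Bool × (Fin (m + 1) → F)) := fun j => (Ioo 0 ℓ).image (W j) with hI
  have hIcard : ∀ j, #(I j) ≤ ℓ - 1 := fun j => card_image_le.trans (by simp)
  have hIsub : ∀ j, (range (ℓ + 1)).image (W j) = insert (true, x) (insert (false, y) (I j)) := by
    intro j
    have : range (ℓ + 1) = insert 0 (insert ℓ (Ioo 0 ℓ)) := by ext i; simp; omega
    rw [this, image_insert, image_insert]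
    simp [hW, hI, hℓ, h.start, h.finish]
  have hcardj : ∀ j, #(I j) + 1 ≤ #((range ℓ).image (e j)) := by
    intro j
    have h1 := card_image_walk_le (W j) (e j) (fun i n hin hen => by
      simp only [he, hW, walkPoint, walkLine, Prod.mk.injEq] at hen ⊢
      by_cases hi : Even i <;> by_cases hn : Even n <;> simp [hi, hn, Nat.even_add_one] at hen ⊢
      all_goals simp [hen]) ℓ
    rw [hIsub, card_insert_of_notMem, card_insert_of_notMem] at h1
    · omega
    · simp only [hI, hW, mem_image, mem_Ioo, Prod.mk.injEq, decide_eq_false_iff_not, not_exists,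
        not_and]
      exact fun i hi hp => h.ne_finish j i hi.1 hi.2 hp
    · simp only [hI, hW, mem_insert, mem_image, mem_Ioo, Prod.mk.injEq, decide_eq_true_eq,
        not_exists, not_and, not_or]
      exact ⟨by simp, fun i hi hp => h.ne_start j i hi.1 hi.2 hp⟩
  have hV : #(vertices ℓ w) ≤ 2 + ∑ j, #(I j) := by
    have : vertices ℓ w ⊆ {(true, x), (false, y)} ∪ univ.biUnion I := by
      refine biUnion_subset.2 fun j _ => ?_
      change (range (ℓ + 1)).image (W j) ⊆ _
      rw [hIsub]
      intro v hv
      simp only [mem_insert, mem_union, mem_singleton, mem_biUnion, mem_univ, true_and] at hv ⊢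
      rcases hv with hv | hv | hv
      · simp [hv]
      · simp [hv]
      · exact Or.inr ⟨j, hv⟩
    refine (card_le_card this).trans ((card_union_le _ _).trans ?_)
    exact Nat.add_le_add card_le_two card_biUnion_le
  have hE : #(edges ℓ w) = ∑ j, #((range ℓ).image (e j)) := by
    refine card_biUnion fun j _ j' _ hj => ?_
    refine Finset.disjoint_left.2 ?_
    intro a ha ha'
    obtain ⟨i, hi, rfl⟩ := mem_image.1 ha
    obtain ⟨i', hi', hii'⟩ := mem_image.1 ha'
    rw [Prod.mk.injEq] at hii'
    exact hj (h.eq_of_common_edge hℓ hℓ1 (mem_range.1 hi) (mem_range.1 hi') hii'.1.symm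
      hii'.2.symm)
  have hsum : ∀ j, ℓ * #(I j) ≤ (ℓ - 1) * #((range ℓ).image (e j)) := by
    intro j
    obtain ⟨k, rfl⟩ : ∃ k, ℓ = k + 1 := ⟨ℓ - 1, by omega⟩
    have h1 := hcardj j
    have h2 := hIcard j
    simp only [Nat.add_sub_cancel] at *
    calc (k + 1) * #(I j) = k * #(I j) + #(I j) := by ring
      _ ≤ k * #(I j) + k := by omega
      _ = k * (#(I j) + 1) := by ring
      _ ≤ _ := Nat.mul_le_mul_left _ h1
  calc ℓ * #(vertices ℓ w) ≤ ℓ * (2 + ∑ j, #(I j)) := Nat.mul_le_mul_left _ hV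
    _ = 2 * ℓ + ∑ j, ℓ * #(I j) := by rw [mul_add, mul_sum]; ring
    _ ≤ 2 * ℓ + ∑ j, (ℓ - 1) * #((range ℓ).image (e j)) := 
        Nat.add_le_add_left (sum_le_sum fun j _ => hsum j) _
    _ = _ := by rw [hE, mul_sum]

/-- Over a field, the coefficients of a walk family together with the first parameters of
`2 ℓ + 1` walks are never algebraically independent. -/
theorem not_algebraicIndependent {k Ω : Type*} [Field k] [Field Ω] [Algebra k Ω] [Fintype ι]
    {c : PolyCoeffs m r → Ω} {x y : Fin (m + 1) → Ω} {w : ι → ℕ → Fin (m + 1) → Ω}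
    (h : IsWalkFamily (m + 1) c x y w) (hm : 0 < m) (hodd : ¬ Even (m + 1))
    (hι : 2 * (m + 1) < Fintype.card ι) (hr : Fintype.card ι * (m + 1) ≤ r) :
    ¬ AlgebraicIndependent k (Sum.elim (fun j => w j 1 0) c) := by
  classical
  intro hind
  have hV := h.card_vertices_le hodd (by omega)
  have hEcard : (edges (m + 1) w).card ≤ Fintype.card ι * (m + 1) := card_edges_le _ _
  set 𝓥 := vertices (m + 1) w with h𝓥
  set 𝓔 := edges (m + 1) w with h𝓔
  have hmemV : ∀ j i, i ≤ m + 1 → (decide (Even i), w j i) ∈ 𝓥 := fun j i hi =>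
    Finset.mem_biUnion.2 ⟨j, Finset.mem_univ _, Finset.mem_image.2
      ⟨i, Finset.mem_range.2 (by omega), rfl⟩⟩
  have hmemE : ∀ e ∈ 𝓔, (∃ b, (b, e.1) ∈ 𝓥) ∧ (∃ b, (b, e.2) ∈ 𝓥) ∧ PolyIncident c e.1 e.2 := by
    intro e he
    obtain ⟨j, -, he⟩ := Finset.mem_biUnion.1 he
    obtain ⟨i, hi, rfl⟩ := Finset.mem_image.1 he
    rw [Finset.mem_range] at hi
    refine ⟨?_, ?_, h.incident j i hi⟩
    · simp only [walkPoint]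
      split_ifs
      · exact ⟨_, hmemV j i (by omega)⟩
      · exact ⟨_, hmemV j (i + 1) (by omega)⟩
    · simp only [walkLine]
      split_ifs
      · exact ⟨_, hmemV j (i + 1) (by omega)⟩
      · exact ⟨_, hmemV j i (by omega)⟩
  let P : 𝓔 → Fin (m + 2) → Ω := fun e => Fin.cons (e.1.2 0) e.1.1
  have hP : Function.Injective P := by
    intro e e' hee
    obtain ⟨h0, h1⟩ := Fin.cons_inj.1 hee
    refine Subtype.ext (Prod.ext h1 (funext fun i => ?_))
    refine Fin.cases h0 (fun i => ?_) i
    rw [(hmemE e.1 e.2).2.2 i, (hmemE e'.1 e'.2).2.2 i, h0, h1]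
  obtain ⟨J, hJcard, hJ⟩ := (linearIndependent_monomials_eval hP
    (r := r) (by simpa using hEcard.trans hr)).exists_pivots
  let S : Finset Ω := (𝓥 ×ˢ Finset.univ).image (fun v => v.1.2 v.2) ∪
    (Finset.univ ×ˢ Jᶜ).image c
  have hScard : S.card ≤ (m + 1) * 𝓥.card + m * (r ^ (m + 2) - 𝓔.card) := by
    refine (Finset.card_union_le _ _).trans (Nat.add_le_add ?_ ?_)
    · refine Finset.card_image_le.trans ?_
      simp [mul_comm]
    · refine Finset.card_image_le.trans ?_
      simp [Finset.card_compl, hJcard]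
  have hJle : 𝓔.card ≤ r ^ (m + 2) := by
    have := Finset.card_le_univ J
    simpa [hJcard] using this
  let K := IntermediateField.adjoin k (S : Set Ω)
  have hSK : ∀ z ∈ S, z ∈ K := fun z hz => IntermediateField.subset_adjoin _ _ hz
  have hVK : ∀ v ∈ 𝓥, ∀ i, v.2 i ∈ K := fun v hv i => hSK _ <| Finset.mem_union_left _ <|
    Finset.mem_image.2 ⟨(v, i), by simp [hv], rfl⟩
  have hcK : ∀ z, c z ∈ K := by
    rintro ⟨i, α⟩
    refine hJ K.toSubfield ?_ (fun α => c (i, α)) ?_ ?_ α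
    · intro e α
      refine prod_mem fun v _ => pow_mem ?_ _
      obtain ⟨⟨b, hb⟩, ⟨b', hb'⟩, -⟩ := hmemE e.1 e.2
      refine Fin.cases ?_ (fun v => ?_) v
      · exact hVK _ hb' 0
      · exact hVK _ hb v
    · intro e
      obtain ⟨-, ⟨b', hb'⟩, hinc⟩ := hmemE e.1 e.2
      rw [← hinc i]
      exact hVK _ hb' _
    · intro α hα
      exact hSK _ <| Finset.mem_union_right _ <| Finset.mem_image.2 ⟨(i, α), by simp [hα], rfl⟩
  have hcard := hind.card_le_of_mem_adjoin S (by
    rintro (j | z)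
    · exact hVK _ (hmemV j 1 (by omega)) 0
    · exact hcK z)
  simp only [Fintype.card_sum, Fintype.card_prod, Fintype.card_fin, Fintype.card_fun] at hcard
  have h1 : m * (r ^ (m + 2) - 𝓔.card) + m * 𝓔.card = m * r ^ (m + 2) := by
    rw [← mul_add, Nat.sub_add_cancel hJle]
  simp only [Nat.add_sub_cancel] at hV
  omega

end IsWalkFamily

theorem PolyIncident.map {F F' : Type*} [CommRing F] [CommRing F'] {m r : ℕ}
    {c : PolyCoeffs m r → F} {a b : Fin (m + 1) → F} (h : PolyIncident c a b) (φ : F →+* F') :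
    PolyIncident (φ ∘ c) (φ ∘ a) (φ ∘ b) := by
  intro i
  have hcons : (Fin.cons ((φ ∘ b) 0) (φ ∘ a) : Fin (m + 2) → F') =
      φ ∘ (Fin.cons (b 0) a : Fin (m + 2) → F) := by
    ext v
    refine Fin.cases rfl (fun v => rfl) v
  rw [hcons, Function.comp_apply, h i, map_sum]
  simp [map_prod]

/-- Tuples in a product of fields that differ in every factor have different images under ring
homomorphisms. -/
theorem RingHom.comp_ne_comp_of_forall_ne {γ ν R' : Type*} [Fintype ν] {F : γ → Type*}
    [∀ g, Field (F g)] [CommRing R'] [Nontrivial R'] (φ : (∀ g, F g) →+* R')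
    {a b : ν → ∀ g, F g} (h : ∀ g, (fun i => a i g) ≠ fun i => b i g) : φ ∘ a ≠ φ ∘ b := by
  classical
  intro hab
  have h' : ∀ g, ∃ i, a i g ≠ b i g := fun g => Function.ne_iff.1 (h g)
  choose i hi using h'
  have h1 : (1 : ∀ g, F g) = ∑ v, (fun g => if v = i g then (a v g - b v g)⁻¹ else 0) *
      (a v - b v) := by
    ext g
    rw [Finset.sum_apply, Finset.sum_eq_single (i g)]
    · simp [inv_mul_cancel₀ (sub_ne_zero.2 (hi g))]
    · intro v _ hv
      simp [hv]
    · simp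
  have h2 := congrArg φ h1
  rw [map_one, map_sum, Finset.sum_eq_zero] at h2
  · exact one_ne_zero h2
  · intro v _
    rw [map_mul, map_sub, show φ (a v) = φ (b v) from congrFun hab v, sub_self, mul_zero]

theorem walkPoint_comp {V V' : Type*} (f : V → V') (w : ℕ → V) (i : ℕ) :
    walkPoint (fun i => f (w i)) i = f (walkPoint w i) := by
  unfold walkPoint; split_ifs <;> rfl

theorem walkLine_comp {V V' : Type*} (f : V → V') (w : ℕ → V) (i : ℕ) :
    walkLine (fun i => f (w i)) i = f (walkLine w i) := by
  unfold walkLine; split_ifs <;> rfl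

namespace IsWalkFamily

/-- Walk families over fields `F g` induce walk families over every nontrivial ring receiving a
homomorphism from the product of the `F g`. -/
theorem map_pi {γ ι R' : Type*} {F : γ → Type*} [∀ g, Field (F g)] [CommRing R'] [Nontrivial R']
    {m r ℓ : ℕ} {c : ∀ g, PolyCoeffs m r → F g} {x y : ∀ g, Fin (m + 1) → F g}
    {w : ∀ g, ι → ℕ → Fin (m + 1) → F g} (h : ∀ g, IsWalkFamily ℓ (c g) (x g) (y g) (w g))
    (φ : (∀ g, F g) →+* R') :
    IsWalkFamily ℓ (φ ∘ fun z g => c g z) (φ ∘ fun i g => x g i) (φ ∘ fun i g => y g i)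
      (fun j n => φ ∘ fun i g => w g j n i) where
  start j := by
    congr 1; ext i g; exact congrFun ((h g).start j) i
  finish j := by
    congr 1; ext i g; exact congrFun ((h g).finish j) i
  incident j i hi := by
    rw [walkPoint_comp (fun u => φ ∘ u) (fun n i g => w g j n i),
      walkLine_comp (fun u => φ ∘ u) (fun n i g => w g j n i)]
    refine PolyIncident.map ?_ φ
    intro z
    ext g
    have h1 := (h g).incident j i hi z
    have hp : walkPoint (w g j) i = fun v => walkPoint (fun n i g => w g j n i) i v g :=
      walkPoint_comp (fun (u : Fin (m + 1) → ∀ g, F g) v => u v g) (fun n i g => w g j n i) i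
    have hl : walkLine (w g j) i = fun v => walkLine (fun n i g => w g j n i) i v g :=
      walkLine_comp (fun (u : Fin (m + 1) → ∀ g, F g) v => u v g) (fun n i g => w g j n i) i
    rw [hp, hl] at h1
    refine h1.trans ?_
    rw [Finset.sum_apply]
    refine Finset.sum_congr rfl fun α _ => ?_
    rw [Pi.mul_apply, Finset.prod_apply]
    congr 1
    refine Finset.prod_congr rfl fun v _ => ?_
    rw [Pi.pow_apply]
    congr 1
    refine Fin.cases rfl (fun v => rfl) v
  ne_start j i h0 h1 hp := φ.comp_ne_comp_of_forall_ne fun g => (h g).ne_start j i h0 h1 hp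
  ne_finish j i h0 h1 hp := φ.comp_ne_comp_of_forall_ne fun g => (h g).ne_finish j i h0 h1 hp
  disjoint j j' hj i i' h0 h1 h0' h1' hp :=
    φ.comp_ne_comp_of_forall_ne fun g => (h g).disjoint j j' hj i i' h0 h1 h0' h1' hp

theorem reindex {F ι κ : Type*} [CommRing F] {m r ℓ : ℕ} {c : PolyCoeffs m r → F}
    {x y : Fin (m + 1) → F} {w : ι → ℕ → Fin (m + 1) → F} (h : IsWalkFamily ℓ c x y w)
    {f : κ → ι} (hf : Function.Injective f) : IsWalkFamily ℓ c x y (w ∘ f) where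
  start _ := h.start _
  finish _ := h.finish _
  incident _ := h.incident _
  ne_start _ := h.ne_start _
  ne_finish _ := h.ne_finish _
  disjoint _ _ hj := h.disjoint _ _ fun he => hj (hf he)

/-- A single nonzero polynomial relation is satisfied by the coefficients and first parameters of
all walk families of at least `2 ℓ + 1` walks over all fields. -/
theorem exists_relation (k : Type) [Field k] {ι : Type} [Fintype ι] {m r : ℕ} (hm : 0 < m)
    (hodd : ¬ Even (m + 1)) (hι : 2 * (m + 1) < Fintype.card ι)
    (hr : Fintype.card ι * (m + 1) ≤ r) :
    ∃ G : MvPolynomial (ι ⊕ PolyCoeffs m r) k, G ≠ 0 ∧ ∀ (F : Type) [Field F] [Algebra k F]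
      (c : PolyCoeffs m r → F) (x y : Fin (m + 1) → F) (w : ι → ℕ → Fin (m + 1) → F),
      IsWalkFamily (m + 1) c x y w →
        MvPolynomial.aeval (Sum.elim (fun j => w j 1 0) c) G = 0 := by
  by_contra! hcon
  have hcon' : ∀ g : {G : MvPolynomial (ι ⊕ PolyCoeffs m r) k // G ≠ 0}, ∃ (F : Type)
      (_ : Field F) (_ : Algebra k F) (c : PolyCoeffs m r → F) (x y : Fin (m + 1) → F)
      (w : ι → ℕ → Fin (m + 1) → F), IsWalkFamily (m + 1) c x y w ∧
        MvPolynomial.aeval (Sum.elim (fun j => w j 1 0) c) g.1 ≠ 0 := fun g => hcon g.1 g.2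
  choose F iF iA c x y w hw hne using hcon'
  let z : ι ⊕ PolyCoeffs m r → ∀ g, F g :=
    Sum.elim (fun j g => w g j 1 0) (fun a g => c g a)
  have hz : ∀ g (p : MvPolynomial (ι ⊕ PolyCoeffs m r) k),
      MvPolynomial.aeval z p g = MvPolynomial.aeval (Sum.elim (fun j => w g j 1 0) (c g)) p := by
    intro g p
    have h1 : (Pi.evalAlgHom k F g).comp (MvPolynomial.aeval z) =
        MvPolynomial.aeval (Sum.elim (fun j => w g j 1 0) (c g)) := by
      refine MvPolynomial.algHom_ext fun a => ?_
      rcases a with a | a <;> simp [z]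
    exact DFunLike.congr_fun h1 p
  let S : Submonoid (∀ g, F g) :=
    (nonZeroDivisors (MvPolynomial (ι ⊕ PolyCoeffs m r) k)).map (MvPolynomial.aeval (R := k) z)
  have hS : Disjoint ((⊥ : Ideal (∀ g, F g)) : Set (∀ g, F g)) S := by
    rw [Set.disjoint_left]
    rintro _ h0 ⟨p, hp, rfl⟩
    have hp0 : p ≠ 0 := nonZeroDivisors.ne_zero hp
    refine hne ⟨p, hp0⟩ ?_
    rw [← hz]
    exact congrFun ((Submodule.mem_bot _).1 h0) _
  obtain ⟨P, hP, -, hPS⟩ := Ideal.exists_le_prime_disjoint _ S hS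
  let φ : (∀ g, F g) →ₐ[k] FractionRing ((∀ g, F g) ⧸ P) :=
    (IsScalarTower.toAlgHom k ((∀ g, F g) ⧸ P) _).comp (Ideal.Quotient.mkₐ k P)
  have hφ : ∀ a, φ a = 0 → a ∈ P := by
    intro a ha
    have h1 : algebraMap ((∀ g, F g) ⧸ P) (FractionRing ((∀ g, F g) ⧸ P))
      (Ideal.Quotient.mk P a) = 0 := ha
    rw [FaithfulSMul.algebraMap_eq_zero_iff] at h1
    exact Ideal.Quotient.eq_zero_iff_mem.1 h1
  refine (map_pi hw φ.toRingHom).not_algebraicIndependent (k := k) hm hodd hι hr ?_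
  rw [algebraicIndependent_iff]
  intro p hp
  by_contra hp0
  have h1 : MvPolynomial.aeval (φ ∘ z) p = 0 := by
    rw [← hp]
    congr 2
    ext a
    rcases a with a | a <;> rfl
  rw [show (MvPolynomial.aeval (φ ∘ z)) p = φ (MvPolynomial.aeval z p) from
    (MvPolynomial.comp_aeval_apply z φ p).symm] at h1
  exact Set.disjoint_left.1 hPS (hφ _ h1) ⟨p, mem_nonZeroDivisors_of_ne_zero hp0, rfl⟩

/-- Over every sufficiently large finite field there are polynomials for which the size of walk
families is bounded by a constant. -/
theorem exists_coeffs (k : Type) [Field k] {m : ℕ} (hm : 0 < m) (hodd : ¬ Even (m + 1)) :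
    ∃ r D M : ℕ, ∀ (F : Type) [Field F] [Fintype F] [Algebra k F], D < Fintype.card F →
      ∃ c : PolyCoeffs m r → F, ∀ (x y : Fin (m + 1) → F) (w : Fin M → ℕ → Fin (m + 1) → F),
        ¬ IsWalkFamily (m + 1) c x y w := by
  classical
  let s := 2 * (m + 1) + 1
  let r := s * (m + 1)
  obtain ⟨G, hG, hrel⟩ := exists_relation k (ι := Fin s) (r := r) hm hodd (by simp [s])
    (by simp [r])
  let G' := MvPolynomial.sumAlgEquiv k (Fin s) (PolyCoeffs m r) G
  have hG' : G' ≠ 0 := by simpa [G'] using hG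
  obtain ⟨d, hd⟩ := MvPolynomial.ne_zero_iff.1 hG'
  let D := max (G'.coeff d).totalDegree G'.totalDegree
  refine ⟨r, D, s * (D + 1), fun F _ _ _ hD => ?_⟩
  have hc : ∃ c : PolyCoeffs m r → F, MvPolynomial.aeval c (G'.coeff d) ≠ 0 := by
    by_contra! hc
    have h1 : MvPolynomial.map (algebraMap k F) (G'.coeff d) = 0 := by
      refine MvPolynomial.eq_zero_of_eval_zero_at_prod_finset _ (fun _ => Finset.univ) ?_ ?_
      · intro i
        refine lt_of_le_of_lt ?_ hD
        refine (MvPolynomial.degreeOf_le_totalDegree _ _).trans ?_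
        refine (Finset.sup_mono (MvPolynomial.support_map_subset _ _)).trans (le_max_left _ _)
      · intro x _
        rw [MvPolynomial.eval_map, ← MvPolynomial.aeval_def]
        exact hc x
    exact hd (MvPolynomial.map_injective _ (algebraMap k F).injective (h1.trans (map_zero _).symm))
  obtain ⟨c, hc⟩ := hc
  refine ⟨c, fun x y w₀ hw₀ => ?_⟩
  let w : Fin s × Fin (D + 1) → ℕ → Fin (m + 1) → F := w₀ ∘ finProdFinEquiv
  have hw : IsWalkFamily (m + 1) c x y w := hw₀.reindex finProdFinEquiv.injective
  have hinj : Function.Injective fun a => w a 1 0 := by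
    intro a a' haa
    by_contra hne
    refine hw.disjoint a a' hne 1 1 one_pos (by omega) one_pos (by omega) Iff.rfl ?_
    have h1 := hw.incident a 0 (by omega)
    have h2 := hw.incident a' 0 (by omega)
    simp only [walkPoint, walkLine, Even.zero, if_true, hw.start, zero_add] at h1 h2
    funext i
    refine Fin.cases haa (fun i => ?_) i
    have haa' : w a 1 0 = w a' 1 0 := haa
    rw [h1 i, h2 i, haa']
  let H : MvPolynomial (Fin s) F :=
    MvPolynomial.map (MvPolynomial.aeval c : MvPolynomial (PolyCoeffs m r) k →ₐ[k] F).toRingHom G'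
  have hH : ∀ u : Fin s → F, MvPolynomial.eval u H = MvPolynomial.aeval (Sum.elim u c) G := by
    intro u
    have h1 : (MvPolynomial.eval u).comp ((MvPolynomial.map
        (MvPolynomial.aeval c : MvPolynomial (PolyCoeffs m r) k →ₐ[k] F).toRingHom).comp
          (MvPolynomial.sumAlgEquiv k (Fin s) (PolyCoeffs m r) : _ →+* _)) =
        (MvPolynomial.aeval (Sum.elim u c) : _ →ₐ[k] F).toRingHom := by
      refine MvPolynomial.ringHom_ext (fun a => ?_) fun a => ?_
      · simp [MvPolynomial.sumAlgEquiv_C_inl]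
      · rcases a with a | a <;> simp [MvPolynomial.sumAlgEquiv_X_inl, MvPolynomial.sumAlgEquiv_X_inr]
    exact DFunLike.congr_fun h1 G
  have hH0 : H = 0 := by
    refine MvPolynomial.eq_zero_of_eval_zero_at_prod_finset _
      (fun j => Finset.univ.image fun a => w (j, a) 1 0) ?_ ?_
    · intro j
      rw [Finset.card_image_of_injective _ fun a a' h => (Prod.mk.inj (hinj h)).2]
      rw [Finset.card_univ, Fintype.card_fin, Nat.lt_succ_iff]
      refine (MvPolynomial.degreeOf_le_totalDegree _ _).trans ?_
      refine (Finset.sup_mono (MvPolynomial.support_map_subset _ _)).trans (le_max_right _ _)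
    · intro u hu
      have hu' : ∀ j, ∃ a, w (j, a) 1 0 = u j := fun j => by
        simpa using Finset.mem_image.1 (hu j)
      choose a ha using hu'
      rw [hH, ← hrel F c x y _ (hw.reindex (f := fun j => (j, a j))
        fun j j' h => (Prod.mk.inj h).1)]
      congr 2
      ext i
      rcases i with i | i
      · exact (ha i).symm
      · rfl
  refine hc ?_
  have := congrArg (MvPolynomial.coeff d) hH0
  rw [MvPolynomial.coeff_map] at this
  exact this

end IsWalkFamily

open Finset in
/-- In a large family of bounded finite sets of bounded degree there are many pairwise disjoint
sets that avoid a given set. -/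
theorem exists_pairwise_disjoint_of_card_le {α ι : Type*} [DecidableEq α] [Fintype ι]
    (S : ι → Finset α) (Z : Finset α) {a b : ℕ} (ha : ∀ i, #(S i) ≤ a)
    (hb : ∀ v, #{i | v ∈ S i} ≤ b) (M : ℕ) (hM : b * (#Z + a * M) < Fintype.card ι) :
    ∃ f : Fin M → ι, (∀ j, Disjoint (S (f j)) Z) ∧
      Pairwise fun j j' => Disjoint (S (f j)) (S (f j')) := by
  classical
  induction M with
  | zero => exact ⟨Fin.elim0, fun j => j.elim0, fun j => j.elim0⟩
  | succ M ih =>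
    have hM' : b * (#Z + a * M) < Fintype.card ι := lt_of_le_of_lt (by gcongr; omega) hM
    obtain ⟨f, hf, hf'⟩ := ih hM'
    set Z' := Z ∪ univ.biUnion fun j => S (f j) with hZ'
    have hZcard : #Z' ≤ #Z + a * M := by
      refine (card_union_le _ _).trans (Nat.add_le_add_left ?_ _)
      refine (card_biUnion_le_card_mul _ _ a fun j _ => ha _).trans ?_
      simp [mul_comm]
    have hbad : #(Z'.biUnion fun v => ({i | v ∈ S i} : Finset ι)) < Fintype.card ι := by
      refine ((card_biUnion_le_card_mul _ _ b fun v _ => hb v).trans ?_).trans_lt hM'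
      rw [mul_comm]
      gcongr
    obtain ⟨i, hi⟩ : ∃ i, i ∉ Z'.biUnion fun v => ({i | v ∈ S i} : Finset ι) := by
      by_contra! h
      rw [eq_univ_iff_forall.2 h] at hbad
      exact hbad.ne card_univ
    have hdisj : Disjoint (S i) Z' := by
      rw [disjoint_left]
      intro v hv hv'
      exact hi (mem_biUnion.2 ⟨v, hv', by simpa using hv⟩)
    rw [hZ', disjoint_union_right, disjoint_biUnion_right] at hdisj
    refine ⟨Fin.cons i f, Fin.cases hdisj.1 hf, ?_⟩
    intro j j'
    refine Fin.cases (Fin.cases (fun h => (h rfl).elim) (fun j' _ => ?_) j')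
      (fun j => Fin.cases (fun _ => ?_) (fun j' h => ?_) j') j
    · exact hdisj.2 j' (mem_univ _)
    · exact (hdisj.2 j (mem_univ _)).symm
    · exact hf' fun he => h (congrArg _ he)

namespace SimpleGraph

/-- A theta graph in the blow-up of a graph yields internally disjoint walks in the graph. -/
theorem HasTheta.exists_disjoint_walks {V : Type*} {G : SimpleGraph V} {b ℓ t M : ℕ}
    (h : (G.comap (Prod.fst : V × Fin b → V)).HasTheta ℓ t) (ht : b * (2 + ℓ * M) < t) :
    ∃ (x y : V) (w : Fin M → ℕ → V), (∀ j, w j 0 = x) ∧ (∀ j, w j ℓ = y) ∧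
      (∀ j, ∀ i < ℓ, G.Adj (w j i) (w j (i + 1))) ∧
      (∀ j i, 0 < i → i < ℓ → w j i ≠ x ∧ w j i ≠ y) ∧
      ∀ j j', j ≠ j' → ∀ i i', 0 < i → i < ℓ → 0 < i' → i' < ℓ → w j i ≠ w j' i' := by
  classical
  obtain ⟨x, y, p, -, hx, hy, hinj, hadj, hdisj⟩ := h
  let P : Fin t → ℕ → V × Fin b := fun i n => p i ⟨min n ℓ, by omega⟩
  have hPx : ∀ i, P i 0 = x := fun i => by simpa [P] using hx i
  have hPy : ∀ i, P i ℓ = y := fun i => by simpa [P, Fin.last] using hy i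
  have hPinj : ∀ i n n', n ≤ ℓ → n' ≤ ℓ → P i n = P i n' → n = n' := by
    intro i n n' hn hn' he
    simpa [hn, hn'] using congrArg Fin.val (hinj i he)
  let S : Fin t → Finset V := fun i => (Finset.Ioo 0 ℓ).image fun n => (P i n).1
  have hS : ∀ i v, v ∈ S i → ∃ n, (0 < n ∧ n < ℓ) ∧ (P i n).1 = v := fun i v hv => by
    simpa [S] using hv
  have hdeg : ∀ v, (Finset.univ.filter fun i => v ∈ S i).card ≤ b := by
    intro v
    choose! n hn hnv using fun i => hS i v
    rw [← Fintype.card_fin b, ← Finset.card_univ]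
    refine Finset.card_le_card_of_injOn (fun i => (P i (n i)).2) (fun _ _ => Finset.mem_univ _) ?_
    intro i hi i' hi' he
    simp only [Finset.coe_filter, Finset.mem_univ, true_and, Set.mem_ofPred_eq] at hi hi'
    by_contra hne
    have h1 : P i (n i) = P i' (n i') := Prod.ext ((hnv i hi).trans (hnv i' hi').symm) he
    have := hn i hi
    rcases hdisj i i' hne _ _ h1 with h2 | h2
    · have := hPinj i (n i) 0 (by omega) (by omega) (h2.trans (hPx i).symm)
      omega
    · have := hPinj i (n i) ℓ (by omega) (by omega) (h2.trans (hPy i).symm)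
      omega
  have hcard : b * (({x.1, y.1} : Finset V).card + ℓ * M) < Fintype.card (Fin t) := by
    rw [Fintype.card_fin]
    refine lt_of_le_of_lt ?_ ht
    gcongr
    exact Finset.card_le_two
  obtain ⟨f, hf, hf'⟩ := exists_pairwise_disjoint_of_card_le S {x.1, y.1} (a := ℓ) (b := b)
    (fun i => Finset.card_image_le.trans (by simp)) hdeg M hcard
  have hmem : ∀ j i, 0 < i → i < ℓ → (P (f j) i).1 ∈ S (f j) := fun j i h0 h1 =>
    Finset.mem_image_of_mem _ (Finset.mem_Ioo.2 ⟨h0, h1⟩)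
  refine ⟨x.1, y.1, fun j n => (P (f j) n).1, fun j => congrArg _ (hPx _),
    fun j => congrArg _ (hPy _), ?_, ?_, ?_⟩
  · intro j i hi
    have h1 := hadj (f j) ⟨i, hi⟩
    simp only [P, min_eq_left hi.le, min_eq_left (Nat.succ_le_of_lt hi)]
    exact h1
  · intro j i h0 h1
    have h2 := Finset.disjoint_left.1 (hf j) (hmem j i h0 h1)
    simpa using h2
  · intro j j' hj i i' h0 h1 h0' h1' he
    refine Finset.disjoint_left.1 (hf' hj) (hmem j i h0 h1) ?_
    dsimp only at he
    rw [he]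
    exact hmem j' i' h0' h1'

theorem HasTheta.of_map {V W : Type*} {G : SimpleGraph V} (f : V ↪ W) {ℓ t : ℕ} (hℓ : 0 < ℓ)
    (ht : 0 < t) (h : (G.map f).HasTheta ℓ t) : G.HasTheta ℓ t := by
  obtain ⟨x, y, p, hxy, hx, hy, hinj, hadj, hdisj⟩ := h
  have hrange : ∀ i j, ∃ v, f v = p i j := by
    intro i j
    refine Fin.cases ?_ (fun j => ?_) j
    · obtain ⟨u, v, -, hu, -⟩ := (SimpleGraph.map_adj _ _ _ _).1 (hadj i ⟨0, hℓ⟩)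
      exact ⟨u, hu⟩
    · obtain ⟨u, v, -, -, hv⟩ := (SimpleGraph.map_adj _ _ _ _).1 (hadj i j)
      exact ⟨v, hv⟩
  choose P hP using hrange
  have hPx : ∀ i, f (P i 0) = x := fun i => (hP i 0).trans (hx i)
  have hPy : ∀ i, f (P i (Fin.last ℓ)) = y := fun i => (hP i _).trans (hy i)
  refine ⟨P ⟨0, ht⟩ 0, P ⟨0, ht⟩ (Fin.last ℓ), P, fun he => hxy ?_, fun i => f.injective ?_,
    fun i => f.injective ?_, fun i j j' he => hinj i ?_, fun i j => ?_, fun i i' hi j j' he => ?_⟩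
  · rw [← hPx ⟨0, ht⟩, he, hPy]
  · rw [hPx, hPx]
  · rw [hPy, hPy]
  · rw [← hP, ← hP, he]
  · have h1 := hadj i j
    rwa [← hP, ← hP, SimpleGraph.map_adj_apply] at h1
  · rw [← f.injective.eq_iff, ← f.injective.eq_iff (b := P _ (Fin.last ℓ)), hPx, hPy, hP]
    exact hdisj i i' hi j j' (by rw [← hP, ← hP, he])

end SimpleGraph

/-- The incidence graph between points, tagged by `true`, and lines, tagged by `false`. -/
def polyIncidenceGraph {F : Type*} [CommRing F] {m r : ℕ} (c : PolyCoeffs m r → F) :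
    SimpleGraph (Bool × (Fin (m + 1) → F)) where
  Adj u v := u.1 = !v.1 ∧ PolyIncident c (bif u.1 then u.2 else v.2) (bif u.1 then v.2 else u.2)
  symm := ⟨by
    rintro ⟨_ | _, u⟩ ⟨_ | _, v⟩ ⟨h, h'⟩ <;> first | exact ⟨rfl, h'⟩ | cases h⟩
  loopless := ⟨by
    rintro ⟨_ | _, u⟩ h <;> simp at h⟩

theorem isWalkFamily_of_walks {F ι : Type*} [CommRing F] {m r ℓ : ℕ} {c : PolyCoeffs m r → F}
    {x y : Bool × (Fin (m + 1) → F)} {w : ι → ℕ → Bool × (Fin (m + 1) → F)} (hx : x.1 = true)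
    (h0 : ∀ j, w j 0 = x) (hℓ : ∀ j, w j ℓ = y) (hodd : ¬ Even ℓ)
    (hadj : ∀ j, ∀ i < ℓ, (polyIncidenceGraph c).Adj (w j i) (w j (i + 1)))
    (hne : ∀ j i, 0 < i → i < ℓ → w j i ≠ x ∧ w j i ≠ y)
    (hdisj : ∀ j j', j ≠ j' → ∀ i i', 0 < i → i < ℓ → 0 < i' → i' < ℓ → w j i ≠ w j' i') :
    IsWalkFamily ℓ c x.2 y.2 fun j i => (w j i).2 := by
  have htag : ∀ j, ∀ i ≤ ℓ, (w j i).1 = decide (Even i) := by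
    intro j i hi
    induction i with
    | zero => simp [h0, hx]
    | succ i ih =>
      have h1 := (hadj j i (by omega)).1
      rw [ih (by omega)] at h1
      rw [← Bool.not_inj_iff, ← h1]
      by_cases hi : Even i <;> simp [Nat.even_add_one, hi]
  refine ⟨fun j => by rw [h0], fun j => by rw [hℓ], fun j i hi => ?_, fun j i hi hi' hp he => ?_,
    fun j i hi hi' hp he => ?_, fun j j' hj i i' h1 h2 h1' h2' hp he => ?_⟩
  · have h1 := (hadj j i hi).2
    rw [htag j i hi.le] at h1
    by_cases hp : Even i <;> simpa [walkPoint, walkLine, hp] using h1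
  · refine (hne j i hi hi').1 (Prod.ext ?_ he)
    rw [htag j i hi'.le, hx, decide_eq_true hp]
  · refine (hne j i hi hi').2 (Prod.ext ?_ he)
    rw [← hℓ j, htag j i hi'.le, htag j ℓ le_rfl, decide_eq_false hp, decide_eq_false hodd]
  · refine hdisj j j' hj i i' h1 h2 h1' h2' (Prod.ext ?_ he)
    rw [htag j i h2.le, htag j' i' h2'.le]
    exact decide_eq_decide.2 hp

theorem not_hasTheta_blowUp {F : Type*} [CommRing F] {m r ℓ b t M : ℕ} {c : PolyCoeffs m r → F}
    (hodd : ¬ Even ℓ) (ht : b * (2 + ℓ * M) < t)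
    (hc : ∀ (x y : Fin (m + 1) → F) (w : Fin M → ℕ → Fin (m + 1) → F),
      ¬ IsWalkFamily ℓ c x y w) :
    ¬ ((polyIncidenceGraph c).comap
      (Prod.fst : (Bool × (Fin (m + 1) → F)) × Fin b → _)).HasTheta ℓ t := by
  intro h
  obtain ⟨x, y, w, h0, hℓ, hadj, hne, hdisj⟩ := h.exists_disjoint_walks ht
  cases hx : x.1 with
  | true => exact hc _ _ _ (isWalkFamily_of_walks hx h0 hℓ hodd hadj hne hdisj)
  | false =>
    rcases Nat.eq_zero_or_pos M with rfl | hM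
    · exact hc 0 0 Fin.elim0 (by constructor <;> intro j <;> exact j.elim0)
    have hy : y.1 = true := by
      have htag : ∀ i ≤ ℓ, (w ⟨0, hM⟩ i).1 = !decide (Even i) := by
        intro i hi
        induction i with
        | zero => simp [h0, hx]
        | succ i ih =>
          have h1 := (hadj ⟨0, hM⟩ i (by omega)).1
          rw [ih (by omega)] at h1
          by_cases hi : Even i <;> simpa [Nat.even_add_one, hi] using h1.symm
      rw [← hℓ ⟨0, hM⟩, htag ℓ le_rfl, decide_eq_false hodd]
      rfl
    refine hc _ _ _ (isWalkFamily_of_walks (x := y) (y := x) (w := fun j i => w j (ℓ - i)) hy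
      (fun j => hℓ j) (fun j => by rw [Nat.sub_self, h0]) hodd (fun j i hi => ?_)
      (fun j i hi hi' => ?_) fun j j' hj i i' h1 h2 h1' h2' => ?_)
    · have h1 := hadj j (ℓ - (i + 1)) (by omega)
      rw [show ℓ - (i + 1) + 1 = ℓ - i by omega] at h1
      exact h1.symm
    · exact (hne j (ℓ - i) (by omega) (by omega)).symm
    · exact hdisj j j' hj _ _ (by omega) (by omega) (by omega) (by omega)

theorem card_edgeSet_blowUp_ge {F : Type*} [Field F] [Fintype F] {m r b : ℕ}
    (c : PolyCoeffs m r → F) :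
    b ^ 2 * Fintype.card F ^ (m + 2) ≤ Nat.card ((polyIncidenceGraph c).comap
      (Prod.fst : (Bool × (Fin (m + 1) → F)) × Fin b → _)).edgeSet := by
  let line : (Fin (m + 1) → F) → F → Fin (m + 1) → F := fun a s => Fin.cons s fun i =>
    ∑ α : Fin (m + 2) → Fin r, c (i, α) * ∏ v, (Fin.cons s a : Fin (m + 2) → F) v ^ (α v : ℕ)
  have hline : ∀ a s, PolyIncident c a (line a s) := fun a s i => rfl
  let e : (Fin (m + 1) → F) × F × Fin b × Fin b →
      ((polyIncidenceGraph c).comap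
        (Prod.fst : (Bool × (Fin (m + 1) → F)) × Fin b → _)).edgeSet := fun z =>
    ⟨s(((true, z.1), z.2.2.1), ((false, line z.1 z.2.1), z.2.2.2)), rfl, hline _ _⟩
  have he : Function.Injective e := by
    rintro ⟨a, s, i, j⟩ ⟨a', s', i', j'⟩ h
    have h1 := congrArg Subtype.val h
    simp only [e, Sym2.eq_iff, Prod.mk.injEq] at h1
    have h2 : line a s = line a' s' → s = s' := fun h => congrFun h 0
    grind
  have h1 := Nat.card_le_card_of_injective e he
  refine le_trans (le_of_eq ?_) h1
  simp [Nat.card_eq_fintype_card]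
  ring

theorem SimpleGraph.card_edgeSet_map_eq {V W : Type*} (G : SimpleGraph V) (f : V ↪ W) :
    Nat.card (G.map f).edgeSet = Nat.card G.edgeSet := by
  rw [SimpleGraph.edgeSet_map]
  exact Nat.card_image_of_injective f.sym2Map.injective _

theorem rpow_mul_rpow_le_of_lt {ℓ b q t n E C : ℕ} (hℓ : 0 < ℓ) (hC : 0 < C)
    (hn : n ≤ 2 * b * (2 * q) ^ ℓ) (ht : t ≤ 2 * C * b) (hE : b ^ 2 * q ^ (ℓ + 1) ≤ E) :
    (1 / (4 * C ^ 2 * 2 ^ (ℓ + 1)) : ℝ) * (t : ℝ) ^ (1 - 1 / (ℓ : ℝ)) *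
      (n : ℝ) ^ (1 + 1 / (ℓ : ℝ)) ≤ E := by
  have hℓ1 : (1 : ℝ) ≤ ℓ := by exact_mod_cast hℓ
  have hC1 : (1 : ℝ) ≤ C := by exact_mod_cast hC
  have hinv : 1 / (ℓ : ℝ) ≤ 1 := by rw [div_le_one (by positivity)]; exact hℓ1
  have hinv0 : 0 < 1 / (ℓ : ℝ) := by positivity
  have hn' : (n : ℝ) ≤ 2 * C * b * (2 * q) ^ ℓ := by
    calc (n : ℝ) ≤ 2 * b * (2 * q) ^ ℓ := by exact_mod_cast hn
      _ ≤ 2 * C * b * (2 * q) ^ ℓ := by gcongr; nlinarith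
  have ht' : (t : ℝ) ≤ 2 * C * b := by exact_mod_cast ht
  have hE' : (b : ℝ) ^ 2 * q ^ (ℓ + 1) ≤ E := by exact_mod_cast hE
  have hpow : (((2 * q : ℝ)) ^ ℓ) ^ (1 + 1 / (ℓ : ℝ)) = (2 * q) ^ (ℓ + 1) := by
    rw [← Real.rpow_natCast, ← Real.rpow_natCast, ← Real.rpow_mul (by positivity)]
    congr 1
    push_cast
    field_simp
  have hprod : (2 * C * b : ℝ) ^ (1 - 1 / (ℓ : ℝ)) * (2 * C * b : ℝ) ^ (1 + 1 / (ℓ : ℝ)) =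
      (2 * C * b) ^ 2 := by
    rw [← Real.rpow_add_of_nonneg (by positivity) (by linarith) (by linarith), ← Real.rpow_natCast]
    congr 1
    push_cast
    ring
  calc (1 / (4 * C ^ 2 * 2 ^ (ℓ + 1)) : ℝ) * (t : ℝ) ^ (1 - 1 / (ℓ : ℝ)) *
        (n : ℝ) ^ (1 + 1 / (ℓ : ℝ))
      ≤ (1 / (4 * C ^ 2 * 2 ^ (ℓ + 1)) : ℝ) * (2 * C * b) ^ (1 - 1 / (ℓ : ℝ)) *
        (2 * C * b * (2 * q) ^ ℓ) ^ (1 + 1 / (ℓ : ℝ)) := by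
        gcongr
    _ = (1 / (4 * C ^ 2 * 2 ^ (ℓ + 1)) : ℝ) * ((2 * C * b) ^ 2 * (2 * q) ^ (ℓ + 1)) := by
        rw [Real.mul_rpow (x := 2 * C * b) (by positivity) (by positivity), hpow, ← hprod]
        ring
    _ = (b : ℝ) ^ 2 * q ^ (ℓ + 1) := by
        rw [mul_pow (2 : ℝ) (q : ℝ)]
        field_simp
        ring
    _ ≤ E := hE'

/-- For every fixed odd `ℓ ≥ 3` there are `c > 0` and `t₀` such that for every `t ≥ t₀`
there is `n₀` such that for every `n ≥ n₀` there is a `Θ_{ℓ,t}`-free graph on `n`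
vertices with at least `c · t^{1-1/ℓ} · n^{1+1/ℓ}` edges. -/
theorem theta_turan_lower_odd (ℓ : ℕ) (hℓ : 3 ≤ ℓ) (hodd : Odd ℓ) :
    ∃ c : ℝ, 0 < c ∧ ∃ t0 : ℕ, ∀ t : ℕ, t0 ≤ t → ∃ n0 : ℕ, ∀ n : ℕ, n0 ≤ n →
      ∃ G : SimpleGraph (Fin n), ¬ G.HasTheta ℓ t ∧
        c * (t : ℝ) ^ (1 - 1 / (ℓ : ℝ)) * (n : ℝ) ^ (1 + 1 / (ℓ : ℝ))
          ≤ (Nat.card G.edgeSet : ℝ) := by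
  obtain ⟨m, rfl⟩ : ∃ m, ℓ = m + 1 := ⟨ℓ - 1, by omega⟩
  have hodd' : ¬ Even (m + 1) := Nat.not_even_iff_odd.2 hodd
  obtain ⟨r, D, M, hM⟩ := IsWalkFamily.exists_coeffs (ZMod 2) (m := m) (by omega) hodd'
  set C := 3 + (m + 1) * M with hC
  refine ⟨1 / (4 * C ^ 2 * 2 ^ (m + 1 + 1)), by positivity, C, fun t ht => ?_⟩
  set b := t / C with hb
  have hb0 : 0 < b := Nat.div_pos ht (by omega)
  have hbt : b * C ≤ t := Nat.div_mul_le_self t C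
  have hbt' : t < C * (b + 1) := Nat.lt_mul_div_succ t (by omega)
  refine ⟨(2 ^ (m + 1)) ^ (D + 1) * (2 * b), fun n hn => ?_⟩
  set k := Nat.log (2 ^ (m + 1)) (n / (2 * b)) with hk
  have hbase : 1 < 2 ^ (m + 1) := Nat.one_lt_two_pow (by omega)
  have hdiv : (2 ^ (m + 1)) ^ (D + 1) ≤ n / (2 * b) := (Nat.le_div_iff_mul_le (by omega)).2 hn
  have hdiv0 : n / (2 * b) ≠ 0 := (lt_of_lt_of_le (by positivity) hdiv).ne'
  have hkD : D + 1 ≤ k := Nat.le_log_of_pow_le hbase hdiv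
  have hk1 : (2 ^ (m + 1)) ^ k * (2 * b) ≤ n :=
    (Nat.le_div_iff_mul_le (by omega)).1 (Nat.pow_log_le_self _ hdiv0)
  have hk2 : n < (2 ^ (m + 1)) ^ (k + 1) * (2 * b) :=
    (Nat.div_lt_iff_lt_mul (by omega)).1 (Nat.lt_pow_succ_log_self hbase _)
  let _ : Fintype (GaloisField 2 k) := Fintype.ofFinite _
  have hq : Fintype.card (GaloisField 2 k) = 2 ^ k := by
    rw [← Nat.card_eq_fintype_card, GaloisField.card 2 k (by omega)]
  have hDq : D < Fintype.card (GaloisField 2 k) := by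
    rw [hq]
    exact lt_of_lt_of_le (by omega) (Nat.lt_two_pow_self (n := k)).le
  obtain ⟨c, hc⟩ := hM (GaloisField 2 k) hDq
  have hcard : Fintype.card ((Bool × (Fin (m + 1) → GaloisField 2 k)) × Fin b) ≤
      Fintype.card (Fin n) := by
    simp only [Fintype.card_prod, Fintype.card_bool, Fintype.card_pi, Finset.prod_const,
      Finset.card_univ, Fintype.card_fin, hq]
    refine le_trans (le_of_eq ?_) hk1
    rw [← pow_mul, ← pow_mul]
    ring
  obtain ⟨f⟩ := Function.Embedding.nonempty_of_card_le hcard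
  refine ⟨((polyIncidenceGraph c).comap Prod.fst).map f, fun hT => ?_, ?_⟩
  · refine not_hasTheta_blowUp hodd' ?_ hc (hT.of_map f (by omega) (by omega))
    nlinarith
  · rw [SimpleGraph.card_edgeSet_map_eq]
    refine rpow_mul_rpow_le_of_lt (q := 2 ^ k) (by omega) (by omega) ?_ ?_
      (hq ▸ card_edgeSet_blowUp_ge c)
    · refine hk2.le.trans (le_of_eq ?_)
      rw [← pow_succ', ← pow_mul, ← pow_mul]
      ring
    · nlinarith
end

section
/- Let t ≥ 1 be an integer and let G be a bipartite Θ_{3,t}-free graph. Let r be any vertex of G, and call a vertex u bad (with respect to r) if u ≠ r and u has more than t common neighbors with r. Then no neighbor of r is adjacent to t or more bad vertices; i.e., every w ∈ N(r) has fewer than t bad neighbors. -/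
/-- Finite sets indexed by `ι`, each of size at least `|ι|`, have distinct representatives. -/
theorem Finset.exists_injective_mem_of_card_le {ι α : Type*} [Fintype ι] [DecidableEq α]
    (s : ι → Finset α) (h : ∀ i, Fintype.card ι ≤ (s i).card) :
    ∃ f : ι → α, Function.Injective f ∧ ∀ i, f i ∈ s i := by
  refine (Finset.all_card_le_biUnion_card_iff_exists_injective s).1 fun a => ?_
  obtain rfl | ⟨i, hi⟩ := a.eq_empty_or_nonempty
  · simp
  · exact (Finset.card_le_univ a).trans
      ((h i).trans (Finset.card_le_card (Finset.subset_biUnion_of_mem s hi)))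

/-- Disjoint paths `x - u i - c i - y` of length three form a theta graph. -/
theorem SimpleGraph.hasTheta_three {V : Type*} {G : SimpleGraph V} {t : ℕ} {x y : V}
    {u c : Fin t → V} (hxy : x ≠ y) (hu : Function.Injective u) (hc : Function.Injective c)
    (huc : ∀ i j, u i ≠ c j) (huy : ∀ i, u i ≠ y) (hcx : ∀ i, c i ≠ x)
    (hxu : ∀ i, G.Adj x (u i)) (huc_adj : ∀ i, G.Adj (u i) (c i))
    (hcy : ∀ i, G.Adj (c i) y) : G.HasTheta 3 t := by
  have hne : ∀ i, x ≠ u i := fun i => (hxu i).ne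
  have hne' : ∀ i, c i ≠ y := fun i => (hcy i).ne
  refine ⟨x, y, fun i => ![x, u i, c i, y], hxy, fun i => rfl, fun i => rfl, ?_, ?_, ?_⟩
  · intro i j k h
    fin_cases j <;> fin_cases k <;> simp_all [eq_comm]
  · intro i j
    fin_cases j
    exacts [hxu i, huc_adj i, hcy i]
  · intro i k hik j l h
    have h₁ : u i ≠ u k := hu.ne hik
    have h₂ : c i ≠ c k := hc.ne hik
    have h₃ := huc i k
    have h₄ := (huc k i).symm
    fin_cases j <;> fin_cases l <;> simp_all

/-- In a bipartite `Θ_{3,t}`-free graph, for any vertex `r`, no neighbor `w` of `r` is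
adjacent to `t` or more vertices `u` that are *bad*, i.e. `u ≠ r` and `u` has more than
`t` common neighbors with `r`. -/
theorem no_neighbor_of_many_bad {V : Type} [Fintype V] [DecidableEq V]
    (t : ℕ) (ht : 1 ≤ t) (G : SimpleGraph V) [DecidableRel G.Adj]
    (hbip : G.Colorable 2) (hfree : ¬ G.HasTheta 3 t)
    (r w : V) (hw : G.Adj r w) :
    ((G.neighborFinset w).filter
      (fun u => u ≠ r ∧ t < ((G.neighborFinset u) ∩ (G.neighborFinset r)).card)).card
      < t := by
  by_contra! hcard
  obtain ⟨u, hu, hbad⟩ := Finset.exists_injective_mem_of_card_le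
    (fun _ : Fin t => (G.neighborFinset w).filter
      (fun u => u ≠ r ∧ t < ((G.neighborFinset u) ∩ (G.neighborFinset r)).card))
    (fun _ => by simpa using hcard)
  simp only [Finset.mem_filter, SimpleGraph.mem_neighborFinset] at hbad
  obtain ⟨c, hc, hcmem⟩ := Finset.exists_injective_mem_of_card_le
    (fun i : Fin t => ((G.neighborFinset (u i)) ∩ (G.neighborFinset r)).erase w) (by
      intro i
      have := (hbad i).2.2
      have := Finset.pred_card_le_card_erase
        (s := (G.neighborFinset (u i)) ∩ (G.neighborFinset r)) (a := w)
      simp only [Fintype.card_fin]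
      omega)
  simp only [Finset.mem_erase, Finset.mem_inter, SimpleGraph.mem_neighborFinset] at hcmem
  obtain ⟨C⟩ := hbip
  refine hfree (SimpleGraph.hasTheta_three hw.ne.symm hu hc (fun i j h => ?_)
    (fun i => (hbad i).2.1) (fun i => (hcmem i).1) (fun i => (hbad i).1)
    (fun i => (hcmem i).2.1) (fun i => (hcmem i).2.2.symm))
  have h₁ := C.valid hw
  have h₂ := C.valid (hbad i).1
  have h₃ := C.valid (hcmem j).2.2
  rw [← h] at h₃
  omega
end

section
/- Let t ≥ 2 be an integer, let G be a bipartite Θ_{3,t}-free graph, and let r and v be two distinct vertices of G. Then the number of paths r, v_1, v_2, v of length 3 from r to v such that r and v_2 have at most t common neighbors and such that v_1 and v have at most t common neighbors is at most 2t(t−1). -/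
/-- A finite set of pairs whose fibres over both coordinates have at most `d` elements, and whose
subsets with injective coordinate projections have at most `m` elements, has at most `2dm`
elements. -/
theorem Finset.card_le_of_fibers_of_matchings {α β : Type*} [DecidableEq α] [DecidableEq β]
    (F : Finset (α × β)) (d m : ℕ)
    (hfst : ∀ q ∈ F, (F.filter (fun p => p.1 = q.1)).card ≤ d)
    (hsnd : ∀ q ∈ F, (F.filter (fun p => p.2 = q.2)).card ≤ d)
    (hmatch : ∀ M ⊆ F, Set.InjOn Prod.fst (M : Set (α × β)) →
      Set.InjOn Prod.snd (M : Set (α × β)) → M.card ≤ m) :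
    F.card ≤ 2 * d * m := by
  classical
  obtain ⟨M, hM, hmax⟩ := Finset.exists_max_image
    (F.powerset.filter (fun M : Finset (α × β) => Set.InjOn Prod.fst (M : Set (α × β)) ∧
      Set.InjOn Prod.snd (M : Set (α × β)))) Finset.card ⟨∅, by simp⟩
  simp only [Finset.mem_filter, Finset.mem_powerset] at hM hmax
  obtain ⟨hMF, h1, h2⟩ := hM
  have hcover : F ⊆ M.biUnion (fun q =>
      F.filter (fun p => p.1 = q.1) ∪ F.filter (fun p => p.2 = q.2)) := by
    intro p hp
    by_contra hnot
    simp only [Finset.mem_biUnion, Finset.mem_union, Finset.mem_filter, hp, true_and,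
      not_exists, not_and, not_or] at hnot
    have hpM : p ∉ M := fun h => (hnot p h).1 rfl
    have hle := hmax (insert p M) ⟨Finset.insert_subset hp hMF, by
      rw [Finset.coe_insert, Set.injOn_insert (by simpa using hpM)]
      refine ⟨h1, ?_⟩
      rintro ⟨q, hq, hqp⟩
      exact (hnot q hq).1 hqp.symm, by
      rw [Finset.coe_insert, Set.injOn_insert (by simpa using hpM)]
      refine ⟨h2, ?_⟩
      rintro ⟨q, hq, hqp⟩
      exact (hnot q hq).2 hqp.symm⟩
    rw [Finset.card_insert_of_notMem hpM] at hle
    omega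
  calc F.card ≤ _ := Finset.card_le_card hcover
    _ ≤ M.card * (2 * d) := Finset.card_biUnion_le_card_mul _ _ _ fun q hq => by
      have := Finset.card_union_le (F.filter (fun p => p.1 = q.1)) (F.filter (fun p => p.2 = q.2))
      have := hfst q (hMF hq)
      have := hsnd q (hMF hq)
      omega
    _ ≤ m * (2 * d) := Nat.mul_le_mul_right _ (hmatch M hMF h1 h2)
    _ = 2 * d * m := by ring

/-- Paths of length three between two fixed vertices of a bipartite graph, with distinct first
inner vertices and distinct second inner vertices, form a theta graph. -/
theorem SimpleGraph.HasTheta.of_three_paths {V : Type*} {G : SimpleGraph V}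
    (hbip : G.Colorable 2) {r v : V} (hrv : r ≠ v) {t : ℕ} (a b : Fin t → V)
    (ha : Function.Injective a) (hb : Function.Injective b)
    (hra : ∀ i, G.Adj r (a i)) (hab : ∀ i, G.Adj (a i) (b i)) (hbv : ∀ i, G.Adj (b i) v)
    (hrb : ∀ i, r ≠ b i) (hav : ∀ i, a i ≠ v) : G.HasTheta 3 t := by
  obtain ⟨c⟩ := hbip
  have hne : ∀ i j, a i ≠ b j := by
    intro i j h
    have h1 := c.valid (hra i)
    have h2 := c.valid (hra j)
    have h3 := c.valid (hab j)
    rw [h] at h1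
    omega
  refine ⟨r, v, fun i => ![r, a i, b i, v], hrv, fun _ => rfl, fun _ => rfl, ?_, ?_, ?_⟩
  · intro i j k h
    have h1 := (hra i).ne
    have h2 := (hab i).ne
    have h3 := (hbv i).ne
    have h4 := hrb i
    have h5 := hav i
    fin_cases j <;> fin_cases k <;> simp_all [eq_comm]
  · intro i j
    fin_cases j
    · exact hra i
    · exact hab i
    · exact hbv i
  · intro i i' hi j j' h
    have h1 := ha.ne hi
    have h2 := hb.ne hi
    have h3 := hne i i'
    have h4 := hne i' i
    fin_cases j <;> fin_cases j' <;> simp_all [eq_comm]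

/-- In a bipartite `Θ_{3,t}`-free graph, for distinct vertices `r, v`, the number of
paths `r, v₁, v₂, v` of length 3 such that `r` and `v₂` have at most `t` common neighbors
and `v₁` and `v` have at most `t` common neighbors is at most `2t(t-1)`.
(A path here is a pair `(v₁, v₂)` such that `r, v₁, v₂, v` are pairwise distinct with
consecutive vertices adjacent.) -/
theorem few_linear_paths_theta3 {V : Type} [Fintype V] [DecidableEq V]
    (t : ℕ) (ht : 2 ≤ t) (G : SimpleGraph V) [DecidableRel G.Adj]
    (hbip : G.Colorable 2) (hfree : ¬ G.HasTheta 3 t)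
    (r v : V) (hrv : r ≠ v) :
    ((Finset.univ : Finset (V × V)).filter (fun q =>
        G.Adj r q.1 ∧ G.Adj q.1 q.2 ∧ G.Adj q.2 v ∧
        r ≠ q.1 ∧ r ≠ q.2 ∧ q.1 ≠ q.2 ∧ q.1 ≠ v ∧ q.2 ≠ v ∧
        ((G.neighborFinset r) ∩ (G.neighborFinset q.2)).card ≤ t ∧
        ((G.neighborFinset q.1) ∩ (G.neighborFinset v)).card ≤ t)).card
      ≤ 2 * t * (t - 1) := by
  refine Finset.card_le_of_fibers_of_matchings _ t (t - 1) ?_ ?_ ?_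
  · intro q hq
    simp only [Finset.mem_filter, Finset.mem_univ, true_and] at hq
    refine (Finset.card_le_card_of_injOn Prod.snd ?_ ?_).trans hq.2.2.2.2.2.2.2.2.2
    · intro p hp
      simp only [Finset.coe_filter, Finset.mem_filter, Finset.mem_univ, true_and,
        Set.mem_ofPred_eq] at hp
      obtain ⟨⟨-, h12, h2v, -⟩, he⟩ := hp
      simpa [← he] using ⟨h12, h2v.symm⟩
    · intro p hp p' hp' h
      simp only [Finset.coe_filter, Set.mem_ofPred_eq] at hp hp'
      exact Prod.ext (hp.2.trans hp'.2.symm) h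
  · intro q hq
    simp only [Finset.mem_filter, Finset.mem_univ, true_and] at hq
    refine (Finset.card_le_card_of_injOn Prod.fst ?_ ?_).trans hq.2.2.2.2.2.2.2.2.1
    · intro p hp
      simp only [Finset.coe_filter, Finset.mem_filter, Finset.mem_univ, true_and,
        Set.mem_ofPred_eq] at hp
      obtain ⟨⟨hr1, h12, -⟩, he⟩ := hp
      simpa [← he] using ⟨hr1, h12.symm⟩
    · intro p hp p' hp' h
      simp only [Finset.coe_filter, Set.mem_ofPred_eq] at hp hp'
      exact Prod.ext h (hp.2.trans hp'.2.symm)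
  · intro M hM h1 h2
    by_contra! hlt
    obtain ⟨e⟩ : Nonempty (Fin t ↪ M) :=
      Function.Embedding.nonempty_of_card_le (by simp; omega)
    have hmem := fun i => (Finset.mem_filter.mp (hM (e i).2)).2
    exact hfree (.of_three_paths hbip hrv (fun i => (e i).1.1) (fun i => (e i).1.2)
      (fun i j h => e.injective (Subtype.ext (h1 (e i).2 (e j).2 h)))
      (fun i j h => e.injective (Subtype.ext (h2 (e i).2 (e j).2 h)))
      (fun i => (hmem i).1) (fun i => (hmem i).2.1) (fun i => (hmem i).2.2.1)
      (fun i => (hmem i).2.2.2.2.1) (fun i => (hmem i).2.2.2.2.2.2.1))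
end
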